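/- Let T > 0. Let φ : ℝ → ℝ be an increasing homeomorphism of ℝ onto ℝ with φ(0) = 0 satisfying the upper σ-condition at zero: limsup_{s→0⁺} |φ(σ s)|/φ(s) < +∞ for every σ ∈ ℝ with |σ| > 1. Let a : ℝ → ℝ be a locally integrable T-periodic function satisfying (a#) and (a*). Let g : [0,+∞) → [0,+∞) be continuous, regularly oscillating at zero, satisfy (g*), and satisfy lim_{s→0⁺} g(s)/φ(s) = 0. Then there exists λ* > 0 such that for every λ > λ*, the equation (φ(u'))' + λ a(t) g(u) = 0 has at least one T-periodic solution u with u(t) > 0 for all t ∈ ℝ. -/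

import Mathlib

open MeasureTheory Set Filter

noncomputable section

/-- `u` is a `T`-periodic solution of `(φ(u'))' = F t (u t)`: `u` is `T`-periodic,
of class `C¹` (with continuous derivative `du`), and `φ ∘ u'` is absolutely
continuous with derivative `F t (u t)` a.e. (expressed in integral form). -/
def IsPhiLapSol (T : ℝ) (φ : ℝ → ℝ) (F : ℝ → ℝ → ℝ) (u : ℝ → ℝ) : Prop :=
  Function.Periodic u T ∧
  ∃ du : ℝ → ℝ, Continuous du ∧ (∀ t : ℝ, HasDerivAt u (du t) t) ∧
    (∀ t₁ t₂ : ℝ, IntervalIntegrable (fun s => F s (u s)) volume t₁ t₂) ∧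
    ∀ t : ℝ, φ (du t) = φ (du 0) + ∫ s in (0:ℝ)..t, F s (u s)

/-- Condition (a*): there are `N + 1 ≥ 1` pairwise disjoint closed intervals
`[σ n, τ n]` contained in a period, on which `a > 0` a.e., while `a ≤ 0` a.e.
on the rest of the period. -/
def SignChanging (T : ℝ) (a : ℝ → ℝ) (N : ℕ) (σ τ : Fin (N + 1) → ℝ) : Prop :=
  (∀ n, σ n < τ n) ∧
  (∀ m n : Fin (N + 1), m < n → τ m < σ n) ∧
  (∀ n, τ n < σ 0 + T) ∧
  (∀ n, ∀ᵐ t ∂volume, t ∈ Set.Icc (σ n) (τ n) → 0 < a t) ∧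
  (∀ᵐ t ∂volume, t ∈ Set.Ico (σ 0) (σ 0 + T) \ (⋃ n, Set.Icc (σ n) (τ n)) → a t ≤ 0)

/-- `g` is regularly oscillating at zero: `g (ω s) / g s → 1` as `s → 0⁺` and `ω → 1`. -/
def RegOscZero (g : ℝ → ℝ) : Prop :=
  Tendsto (fun p : ℝ × ℝ => g (p.1 * p.2) / g p.2)
    ((nhds 1) ×ˢ (nhdsWithin 0 (Set.Ioi 0))) (nhds 1)

open Topology in
/-- Along the negative gradient, a `C¹` function on `ℝⁿ` decreases at a rate which is locally
uniform near a noncritical point. -/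
theorem eventually_descent {ι : Type*} [Fintype ι] {J : (ι → ℝ) → ℝ} {D : (ι → ℝ) → ι → ℝ}
    (hD : Continuous D)
    (hJD : ∀ u v, HasDerivAt (fun t : ℝ => J (u + t • v)) (∑ i, D u i * v i) 0)
    {u₀ : ι → ℝ} (hu₀ : D u₀ ≠ 0) :
    ∃ δ₀ : ℝ, 0 < δ₀ ∧ ∀ᶠ u in 𝓝 u₀, ∀ δ ∈ Icc 0 δ₀,
      J (u - δ • D u) ≤ J u - δ / 2 * ∑ i, D u i ^ 2 := by
  have hpos : 0 < ∑ i, D u₀ i ^ 2 := by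
    obtain ⟨i, hi⟩ := Function.ne_iff.1 hu₀
    exact Finset.sum_pos' (fun i _ => sq_nonneg _) ⟨i, Finset.mem_univ _, by
      have : D u₀ i ≠ 0 := hi
      positivity⟩
  have hcont : Continuous (fun z : (ι → ℝ) × ℝ =>
      ∑ i, D (z.1 - z.2 • D z.1) i * D z.1 i - 1 / 2 * ∑ i, D z.1 i ^ 2) := by fun_prop
  have hev : ∀ᶠ z : (ι → ℝ) × ℝ in 𝓝 (u₀, 0),
      0 < ∑ i, D (z.1 - z.2 • D z.1) i * D z.1 i - 1 / 2 * ∑ i, D z.1 i ^ 2 := by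
    refine hcont.continuousAt.eventually (lt_mem_nhds ?_)
    simp only [zero_smul, sub_zero, ← sq]
    linarith
  rw [nhds_prod_eq, eventually_prod_iff] at hev
  obtain ⟨pa, ha, pb, hb, hab⟩ := hev
  obtain ⟨ε, hε, hball⟩ := Metric.eventually_nhds_iff.1 hb
  refine ⟨ε / 2, by positivity, ha.mono fun u hu δ hδ => ?_⟩
  have hder : ∀ x : ℝ, HasDerivAt (fun t : ℝ => J (u - t • D u) + t / 2 * ∑ i, D u i ^ 2)
      (-(∑ i, D (u - x • D u) i * D u i) + 1 / 2 * ∑ i, D u i ^ 2) x := by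
    intro x
    have h1 := hJD (u - x • D u) (-D u)
    have h2 : HasDerivAt (fun t : ℝ => J (u - x • D u + (t - x) • (-D u)))
        (∑ i, D (u - x • D u) i * (-D u) i) x := by
      have := HasDerivAt.comp_sub_const (f := fun t : ℝ => J (u - x • D u + t • (-D u))) x x
        (by simpa using h1)
      simpa using this
    have h3 : (fun t : ℝ => J (u - x • D u + (t - x) • (-D u))) = fun t => J (u - t • D u) := by
      funext t
      congr 1
      module
    rw [h3] at h2
    have h4 := h2.add (((hasDerivAt_id x).div_const 2).mul_const (∑ i, D u i ^ 2))
    exact h4.congr_deriv (by simp)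
  have hanti :
      AntitoneOn (fun t : ℝ => J (u - t • D u) + t / 2 * ∑ i, D u i ^ 2) (Icc 0 (ε / 2)) := by
    refine antitoneOn_of_deriv_nonpos (convex_Icc _ _)
      (fun x _ => (hder x).continuousAt.continuousWithinAt)
      (fun x _ => (hder x).differentiableAt.differentiableWithinAt) fun x hx => ?_
    rw [interior_Icc] at hx
    rw [(hder x).deriv]
    have := hab hu (hball (show dist x 0 < ε by
      rw [Real.dist_eq, sub_zero, abs_of_pos hx.1]; linarith [hx.2]))
    simp only at this
    linarith
  have := hanti (left_mem_Icc.2 (by positivity)) hδ hδ.1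
  simp only [zero_smul, sub_zero, zero_div, zero_mul, add_zero] at this
  linarith

open Topology in
/-- A mountain pass theorem in finite dimension. -/
theorem exists_critical_of_barrier {ι : Type*} [Fintype ι] {J : (ι → ℝ) → ℝ}
    {D : (ι → ℝ) → ι → ℝ} (hJ : Continuous J) (hD : Continuous D)
    (hJD : ∀ u v, HasDerivAt (fun t : ℝ => J (u + t • v)) (∑ i, D u i * v i) 0)
    {R ε : ℝ} (hε : 0 < ε) (hps : ∀ u, R ≤ ‖u‖ → ε ≤ ‖D u‖)
    {q : (ι → ℝ) → ℝ} (hq : Continuous q) {r c : ℝ} {e : ι → ℝ}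
    (hq0 : q 0 < r) (hJ0 : J 0 < c) (hqe : r < q e) (hJe : J e < c)
    (hbar : ∀ u, q u = r → c ≤ J u) :
    ∃ u, D u = 0 ∧ c ≤ J u := by
  by_contra! hno
  have hne : ∀ u, c ≤ J u → D u ≠ 0 := fun u hu h => absurd hu (hno u h).not_ge
  -- a continuous step size
  obtain ⟨δ, hδ⟩ := exists_continuous_forall_mem_convex_of_local_const
    (t := fun u : ι → ℝ => {d : ℝ | (0 ≤ d ∧ ∀ d' ∈ Icc 0 d,
      J (u - d' • D u) ≤ J u - d' / 2 * ∑ i, D u i ^ 2) ∧ (c ≤ J u → 0 < d)})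
    (fun u => by
      refine Set.OrdConnected.convex ⟨fun x hx y hy z hz => ⟨⟨hx.1.1.trans hz.1, fun d' hd' =>
        hy.1.2 d' ⟨hd'.1, hd'.2.trans hz.2⟩⟩, fun h => (hx.2 h).trans_le hz.1⟩⟩)
    (fun u => by
      by_cases hu : D u = 0
      · refine ⟨0, (hJ.continuousAt.eventually (gt_mem_nhds (hno u hu))).mono fun y hy => ?_⟩
        refine ⟨⟨le_rfl, fun d' hd' => ?_⟩, fun h => absurd h hy.not_ge⟩
        have : d' = 0 := le_antisymm hd'.2 hd'.1
        simp [this]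
      · obtain ⟨δ₀, h0, h⟩ := eventually_descent hD hJD hu
        exact ⟨δ₀, h.mono fun y hy => ⟨⟨h0.le, hy⟩, fun _ => h0⟩⟩)
  set S : (ι → ℝ) → ι → ℝ := fun u => u - δ u • D u with hS
  have hSc : Continuous S := by fun_prop
  have hsq : ∀ u, 0 ≤ ∑ i, D u i ^ 2 := fun u => Finset.sum_nonneg fun i _ => sq_nonneg _
  have hdesc : ∀ u, J (S u) ≤ J u - δ u / 2 * ∑ i, D u i ^ 2 := fun u =>
    (hδ u).1.2 _ ⟨(hδ u).1.1, le_rfl⟩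
  have hmono : ∀ u, J (S u) ≤ J u := fun u =>
    (hdesc u).trans (sub_le_self _ (mul_nonneg (by linarith [(hδ u).1.1]) (hsq u)))
  -- below level `c` the segment from `u` to `S u` does not meet the barrier
  have hseg : ∀ u, J u < c → ∀ t ∈ Icc (0 : ℝ) (δ u), q (u - t • D u) ≠ r := by
    intro u hu t ht h
    have h1 := (hδ u).1.2 t ht
    have h2 := hbar _ h
    have h3 : 0 ≤ t / 2 * ∑ i, D u i ^ 2 := mul_nonneg (by linarith [ht.1]) (hsq u)
    linarith
  have hsegc : ∀ u, ContinuousOn (fun t : ℝ => q (u - t • D u)) (Icc 0 (δ u)) := fun u =>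
    (hq.comp (by fun_prop)).continuousOn
  have hlow : ∀ u, J u < c → q u < r → q (S u) < r := by
    intro u hu hqu
    by_contra! h
    obtain ⟨t, ht, htr⟩ := intermediate_value_Icc (hδ u).1.1 (hsegc u)
      (show r ∈ Icc (q (u - (0 : ℝ) • D u)) (q (u - δ u • D u)) from ⟨by simpa using hqu.le, h⟩)
    exact hseg u hu t ht htr
  have hhigh : ∀ u, J u < c → r < q u → r < q (S u) := by
    intro u hu hqu
    by_contra! h
    obtain ⟨t, ht, htr⟩ := intermediate_value_Icc' (hδ u).1.1 (hsegc u)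
      (show r ∈ Icc (q (u - δ u • D u)) (q (u - (0 : ℝ) • D u)) from ⟨h, by simpa using hqu.le⟩)
    exact hseg u hu t ht htr
  have hit0 : ∀ k : ℕ, J (S^[k] 0) < c ∧ q (S^[k] 0) < r := by
    intro k
    induction k with
    | zero => exact ⟨hJ0, hq0⟩
    | succ k ih =>
      rw [Function.iterate_succ_apply']
      exact ⟨(hmono _).trans_lt ih.1, hlow _ ih.1 ih.2⟩
  have hite : ∀ k : ℕ, J (S^[k] e) < c ∧ r < q (S^[k] e) := by
    intro k
    induction k with
    | zero => exact ⟨hJe, hqe⟩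
    | succ k ih =>
      rw [Function.iterate_succ_apply']
      exact ⟨(hmono _).trans_lt ih.1, hhigh _ ih.1 ih.2⟩
  -- a starting point whose whole orbit stays above level `c`
  obtain ⟨s, hs⟩ : (⋂ k : ℕ, {s : ℝ | s ∈ Icc (0 : ℝ) 1 ∧ c ≤ J (S^[k] (s • e))}).Nonempty := by
    have hcl : ∀ k : ℕ, IsClosed {s : ℝ | s ∈ Icc (0 : ℝ) 1 ∧ c ≤ J (S^[k] (s • e))} := fun k =>
      isClosed_Icc.inter (isClosed_le continuous_const
        (hJ.comp ((hSc.iterate k).comp (by fun_prop))))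
    refine IsCompact.nonempty_iInter_of_sequence_nonempty_isCompact_isClosed _ ?_ ?_ ?_ hcl
    · rintro k s ⟨h1, h2⟩
      refine ⟨h1, h2.trans ?_⟩
      rw [Function.iterate_succ_apply']
      exact hmono _
    · intro k
      have hc : ContinuousOn (fun s : ℝ => q (S^[k] (s • e))) (Icc 0 1) :=
        (hq.comp ((hSc.iterate k).comp (by fun_prop))).continuousOn
      obtain ⟨s, hs, hsr⟩ := intermediate_value_Icc zero_le_one hc
        (show r ∈ Icc (q (S^[k] ((0 : ℝ) • e))) (q (S^[k] ((1 : ℝ) • e))) from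
          ⟨by simpa using (hit0 k).2.le, by simpa using (hite k).2.le⟩)
      exact ⟨s, hs, hbar _ hsr⟩
    · exact isCompact_Icc.of_isClosed_subset (hcl 0) fun s h => h.1
  set x : ℕ → ι → ℝ := fun k => S^[k] (s • e) with hx
  have hxc : ∀ k, c ≤ J (x k) := fun k => (mem_iInter.1 hs k).2
  have hxs : ∀ k, x (k + 1) = S (x k) := fun k => Function.iterate_succ_apply' _ _ _
  obtain ⟨ε₁, hε₁, hgrad⟩ : ∃ ε₁ > 0, ∀ u, c ≤ J u → ε₁ ≤ ‖D u‖ := by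
    have hK : IsCompact (Metric.closedBall (0 : ι → ℝ) R ∩ {u | c ≤ J u}) :=
      (isCompact_closedBall _ _).inter_right (isClosed_le continuous_const hJ)
    rcases (Metric.closedBall (0 : ι → ℝ) R ∩ {u | c ≤ J u}).eq_empty_or_nonempty with h | h
    · refine ⟨ε, hε, fun u hu => hps u ?_⟩
      by_contra! hR
      have : u ∈ Metric.closedBall (0 : ι → ℝ) R ∩ {u | c ≤ J u} :=
        ⟨by simpa using hR.le, hu⟩
      rw [h] at this
      exact this
    · obtain ⟨v, hv, hmin⟩ := hK.exists_isMinOn h hD.norm.continuousOn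
      refine ⟨min ε ‖D v‖, lt_min hε (norm_pos_iff.2 (hne v hv.2)), fun u hu => ?_⟩
      rcases le_total R ‖u‖ with hR | hR
      · exact (min_le_left _ _).trans (hps u hR)
      · exact (min_le_right _ _).trans (hmin ⟨by simpa using hR, hu⟩)
  have hnorm : ∀ w : ι → ℝ, ‖w‖ ^ 2 ≤ ∑ i, w i ^ 2 := by
    intro w
    refine (Real.le_sqrt (norm_nonneg w) (Finset.sum_nonneg fun i _ => sq_nonneg _)).1 <|
      (pi_norm_le_iff_of_nonneg (Real.sqrt_nonneg _)).2 fun i => Real.abs_le_sqrt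
      (Finset.single_le_sum (f := fun i => w i ^ 2) (fun i _ => sq_nonneg _) (Finset.mem_univ i))
  have hstep : ∀ k, dist (x k) (x (k + 1)) ≤ 2 / ε₁ * (J (x k) - J (x (k + 1))) := by
    intro k
    have h1 := hdesc (x k)
    rw [← hxs] at h1
    have h2 := hgrad _ (hxc k)
    have h3 := hnorm (D (x k))
    have h4 := (hδ (x k)).1.1
    have h5 : dist (x k) (x (k + 1)) = δ (x k) * ‖D (x k)‖ := by
      rw [hxs, hS, dist_eq_norm]
      simp [norm_smul, abs_of_nonneg h4]
    rw [h5, div_mul_eq_mul_div, le_div_iff₀ hε₁]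
    nlinarith [mul_le_mul_of_nonneg_left h3 h4,
      mul_le_mul_of_nonneg_left h2 (mul_nonneg h4 (norm_nonneg (D (x k))))]
  have hsum : Summable fun k => dist (x k) (x (k + 1)) := by
    refine summable_of_sum_range_le (c := 2 / ε₁ * (J (x 0) - c)) (fun k => dist_nonneg) fun n => ?_
    refine (Finset.sum_le_sum fun k _ => hstep k).trans ?_
    rw [← Finset.mul_sum, Finset.sum_range_sub']
    have := hxc n
    gcongr
  obtain ⟨v, hv⟩ := cauchySeq_tendsto_of_complete (cauchySeq_of_summable_dist hsum)
  have hvc : c ≤ J v := ge_of_tendsto' ((hJ.tendsto v).comp hv) hxc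
  have hfix : S v = v := by
    refine tendsto_nhds_unique (((hSc.tendsto v).comp hv).congr fun k => (hxs k).symm) ?_
    exact hv.comp (tendsto_add_atTop_nat 1)
  have h0 : δ v • D v = 0 := by simpa [hS] using hfix
  rcases smul_eq_zero.1 h0 with h | h
  · exact ((hδ v).2 hvc).ne' h
  · exact hne v hvc h

/-- The primitive of `φ` vanishing at zero. -/
def potential (φ : ℝ → ℝ) (x : ℝ) : ℝ := ∫ s in (0 : ℝ)..x, φ s

theorem hasDerivAt_potential {φ : ℝ → ℝ} (hφ : Continuous φ) (x : ℝ) :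
    HasDerivAt (potential φ) (φ x) x :=
  (hφ.integral_hasStrictDerivAt 0 x).hasDerivAt

theorem continuous_potential {φ : ℝ → ℝ} (hφ : Continuous φ) : Continuous (potential φ) :=
  continuous_iff_continuousAt.2 fun x => (hasDerivAt_potential hφ x).continuousAt

@[simp]
theorem potential_zero (φ : ℝ → ℝ) : potential φ 0 = 0 := intervalIntegral.integral_same

/-- The primitive of a monotone function lies above its tangents. -/
theorem Monotone.potential_add_le {φ : ℝ → ℝ} (hφ : Continuous φ) (hm : Monotone φ) (x y : ℝ) :
    potential φ y + φ y * (x - y) ≤ potential φ x := by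
  have hsub : potential φ x - potential φ y = ∫ s in y..x, φ s :=
    intervalIntegral.integral_interval_sub_left (hφ.intervalIntegrable _ _)
      (hφ.intervalIntegrable _ _)
  rcases le_total y x with h | h
  · have := intervalIntegral.integral_mono_on h (intervalIntegrable_const (μ := volume))
      (hφ.intervalIntegrable y x) fun s hs => hm hs.1
    rw [intervalIntegral.integral_const, smul_eq_mul] at this
    linarith
  · have := intervalIntegral.integral_mono_on h (hφ.intervalIntegrable x y)
      (intervalIntegrable_const (μ := volume)) fun s hs => hm hs.2
    rw [intervalIntegral.integral_const, smul_eq_mul, intervalIntegral.integral_symm] at this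
    linarith

theorem Monotone.potential_nonneg {φ : ℝ → ℝ} (hφ : Continuous φ) (hm : Monotone φ)
    (h0 : φ 0 = 0) (x : ℝ) : 0 ≤ potential φ x := by
  simpa [h0] using hm.potential_add_le hφ x 0

theorem Monotone.potential_le_mul {φ : ℝ → ℝ} (hφ : Continuous φ) (hm : Monotone φ) (x : ℝ) :
    potential φ x ≤ φ x * x := by
  have := hm.potential_add_le hφ 0 x
  rw [potential_zero] at this
  linarith

theorem Monotone.mul_sub_le_potential {φ : ℝ → ℝ} (hφ : Continuous φ) (hm : Monotone φ)
    (h0 : φ 0 = 0) (x y : ℝ) : φ y * (x - y) ≤ potential φ x := by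
  have := hm.potential_add_le hφ x y
  have := hm.potential_nonneg hφ h0 y
  linarith

/-- The discrete energy on a cyclic grid of mesh `h`. -/
def energy {m : ℕ} [NeZero m] (h : ℝ) (φ : ℝ → ℝ) (w : ZMod m → ℝ → ℝ) (u : ZMod m → ℝ) : ℝ :=
  ∑ i, (h * potential φ ((u (i + 1) - u i) / h) - potential (w i) (u i))

/-- The gradient of the discrete energy. -/
def energyGrad {m : ℕ} (h : ℝ) (φ : ℝ → ℝ) (w : ZMod m → ℝ → ℝ) (u : ZMod m → ℝ) (i : ZMod m) : ℝ :=
  φ ((u i - u (i - 1)) / h) - φ ((u (i + 1) - u i) / h) - w i (u i)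

section

variable {m : ℕ} {h : ℝ} {φ : ℝ → ℝ} {w : ZMod m → ℝ → ℝ}

theorem continuous_energy [NeZero m] (hφ : Continuous φ) (hw : ∀ i, Continuous (w i)) :
    Continuous (energy h φ w) := by
  refine continuous_finsetSum _ fun i _ => (continuous_const.mul
    ((continuous_potential hφ).comp (by fun_prop))).sub
      ((continuous_potential (hw i)).comp (by fun_prop))

theorem continuous_energyGrad (hφ : Continuous φ) (hw : ∀ i, Continuous (w i)) :
    Continuous (energyGrad h φ w) :=
  continuous_pi fun i => ((hφ.comp (by fun_prop)).sub (hφ.comp (by fun_prop))).sub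
    ((hw i).comp (by fun_prop))

theorem hasDerivAt_energy [NeZero m] (hh : h ≠ 0) (hφ : Continuous φ) (hw : ∀ i, Continuous (w i))
    (u v : ZMod m → ℝ) :
    HasDerivAt (fun t : ℝ => energy h φ w (u + t • v)) (∑ i, energyGrad h φ w u i * v i) 0 := by
  have hlin : ∀ x y : ℝ, HasDerivAt (fun t : ℝ => x + t * y) y 0 := fun x y => by
    simpa using ((hasDerivAt_id (0 : ℝ)).mul_const y).const_add x
  have hterm : ∀ i, HasDerivAt (fun t : ℝ =>
      h * potential φ (((u + t • v) (i + 1) - (u + t • v) i) / h) - potential (w i) ((u + t • v) i))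
      (φ ((u (i + 1) - u i) / h) * (v (i + 1) - v i) - w i (u i) * v i) 0 := by
    intro i
    have h1 : HasDerivAt (fun t : ℝ => ((u + t • v) (i + 1) - (u + t • v) i) / h)
        ((v (i + 1) - v i) / h) 0 :=
      ((hlin (u (i + 1)) (v (i + 1))).sub (hlin (u i) (v i))).div_const h
    have h2 : HasDerivAt (fun t : ℝ => (u + t • v) i) (v i) 0 := hlin (u i) (v i)
    have h3 := ((hasDerivAt_potential hφ _).comp (0 : ℝ) h1).const_mul h
    have h4 := (hasDerivAt_potential (hw i) _).comp (0 : ℝ) h2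
    refine (h3.sub h4).congr_deriv ?_
    simp only [Pi.add_apply, Pi.zero_apply, zero_smul, add_zero]
    field_simp
  refine (HasDerivAt.fun_sum fun i _ => hterm i).congr_deriv ?_
  have hshift : ∑ i, φ ((u (i + 1) - u i) / h) * v (i + 1)
      = ∑ i, φ ((u i - u (i - 1)) / h) * v i := by
    rw [← Equiv.sum_comp (Equiv.addRight (1 : ZMod m))
      (fun i => φ ((u i - u (i - 1)) / h) * v i)]
    simp
  simp only [energyGrad, mul_sub, sub_mul, Finset.sum_sub_distrib, hshift]

end

/-- The nonlinearity of the truncated discrete problem: a restoring force acts on negative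
values. -/
def nodeForce (b : ℝ) (f : ℝ → ℝ) (s : ℝ) : ℝ := b * f s - min s 0

theorem continuous_nodeForce {f : ℝ → ℝ} (hf : Continuous f) (b : ℝ) :
    Continuous (nodeForce b f) := by
  unfold nodeForce; fun_prop

/-- Existence of a maximizing node. -/
theorem exists_forall_le_node {m : ℕ} [NeZero m] (u : ZMod m → ℝ) : ∃ i, ∀ j, u j ≤ u i :=
  Finite.exists_max u

theorem exists_forall_ge_node {m : ℕ} [NeZero m] (u : ZMod m → ℝ) : ∃ i, ∀ j, u i ≤ u j :=
  Finite.exists_min u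

section

variable {m : ℕ} {h : ℝ} {φ f : ℝ → ℝ} {b : ZMod m → ℝ}

/-- At a minimizing node with negative value the gradient is at most that value. -/
theorem energyGrad_le_of_min (hh : 0 < h) (hm : Monotone φ) (hf0 : ∀ s ≤ 0, f s = 0)
    {u : ZMod m → ℝ} {i : ZMod m} (hi : ∀ j, u i ≤ u j) (hneg : u i ≤ 0) :
    energyGrad h φ (fun i => nodeForce (b i) f) u i ≤ u i := by
  have h1 : φ ((u i - u (i - 1)) / h) ≤ φ ((u (i + 1) - u i) / h) := by
    refine hm (div_le_div_of_nonneg_right ?_ hh.le)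
    linarith [hi (i - 1), hi (i + 1)]
  simp only [energyGrad, nodeForce, hf0 _ hneg, min_eq_left hneg]
  linarith

open Topology in
/-- If `f` outgrows every dilation of `φ`, the gradient of the discrete energy is bounded away
from zero outside a ball. -/
theorem exists_le_norm_energyGrad [NeZero m] (hh : 0 < h) (hm : Monotone φ)
    (hf0 : ∀ s ≤ 0, f s = 0) (hb : ∀ i, b i ≠ 0)
    (hgrow : ∀ ε > 0, ∀ K : ℝ, ∀ᶠ s in atTop, 1 + φ (K * s) - φ (-(K * s)) < ε * f s) :
    ∃ R : ℝ, ∀ u, R ≤ ‖u‖ → 1 ≤ ‖energyGrad h φ (fun i => nodeForce (b i) f) u‖ := by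
  obtain ⟨i₁, hi₁⟩ := Finite.exists_min fun i => |b i|
  have hb₁ : 0 < |b i₁| := abs_pos.2 (hb i₁)
  obtain ⟨R, hR⟩ := eventually_atTop.1 ((hgrow _ hb₁ (2 / h)).and (eventually_ge_atTop 1))
  refine ⟨max R 1, fun u hu => ?_⟩
  by_contra! hlt
  have hD : ∀ i, |energyGrad h φ (fun i => nodeForce (b i) f) u i| < 1 := fun i =>
    (norm_le_pi_norm (energyGrad h φ (fun i => nodeForce (b i) f) u) i).trans_lt hlt
  obtain ⟨i, hi⟩ := exists_forall_ge_node u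
  obtain ⟨k, hk⟩ := exists_forall_le_node u
  have hmin : -1 < u i := by
    rcases le_total 0 (u i) with h0 | h0
    · linarith
    · have := energyGrad_le_of_min (b := b) hh hm hf0 hi h0
      linarith [(abs_lt.1 (hD i)).1]
  have hmax : max R 1 ≤ u k := by
    by_contra! hk'
    refine absurd hu (not_le.2 ((pi_norm_lt_iff (by positivity)).2 fun j => ?_))
    rw [Real.norm_eq_abs, abs_lt]
    exact ⟨by linarith [hi j, le_max_right R 1], (hk j).trans_lt hk'⟩
  obtain ⟨hR1, hR2⟩ := hR _ ((le_max_left _ _).trans hmax)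
  have hfpos : 0 < f (u k) := by
    have := hm (show -(2 / h * u k) ≤ 2 / h * u k by
      have : 0 ≤ 2 / h * u k := by positivity
      linarith)
    by_contra! hc
    nlinarith
  have hg : energyGrad h φ (fun i => nodeForce (b i) f) u k
      = φ ((u k - u (k - 1)) / h) - φ ((u (k + 1) - u k) / h) - b k * f (u k) := by
    simp [energyGrad, nodeForce, min_eq_right (zero_le_one.trans hR2)]
  have hDk := abs_lt.1 (hD k)
  rw [hg] at hDk
  have hbk := hi₁ k
  rcases lt_or_gt_of_ne (hb k) with hneg | hpos
  · have h1 : φ ((u (k + 1) - u k) / h) ≤ φ ((u k - u (k - 1)) / h) := by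
      refine hm (div_le_div_of_nonneg_right ?_ hh.le)
      linarith [hk (k - 1), hk (k + 1)]
    rw [abs_of_neg hneg] at hbk
    have h2 : φ (-(2 / h * u k)) ≤ φ (2 / h * u k) := hm (by
      have : 0 ≤ 2 / h * u k := by positivity
      linarith)
    nlinarith [hDk.2, mul_le_mul_of_nonneg_right hbk hfpos.le]
  · have h1 : φ ((u k - u (k - 1)) / h) ≤ φ (2 / h * u k) := by
      refine hm ?_
      rw [div_mul_eq_mul_div]
      refine div_le_div_of_nonneg_right ?_ hh.le
      linarith [hi (k - 1)]
    have h2 : φ (-(2 / h * u k)) ≤ φ ((u (k + 1) - u k) / h) := by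
      refine hm ?_
      rw [div_mul_eq_mul_div, ← neg_div]
      refine div_le_div_of_nonneg_right ?_ hh.le
      linarith [hi (k + 1)]
    rw [abs_of_pos hpos] at hbk
    nlinarith [hDk.1, mul_le_mul_of_nonneg_right hbk hfpos.le]

/-- The energy of a large spike at a single node with positive weight is negative. -/
theorem exists_energy_single_neg [NeZero m] (hm2 : 2 ≤ m) (hh : 0 < h) (hφ : Continuous φ)
    (hm : Monotone φ)
    (hf : Continuous f) (hfnn : ∀ s, 0 ≤ f s) {i₀ : ZMod m} (hb : 0 < b i₀)
    (hgrow : ∀ ε > 0, ∀ K : ℝ, ∀ᶠ s in atTop, 1 + φ (K * s) - φ (-(K * s)) < ε * f s) (r : ℝ) :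
    ∃ s, 0 < s ∧ r < s ∧ energy h φ (fun i => nodeForce (b i) f) (Pi.single i₀ s) ≤ 0 := by
  have hone : (1 : ZMod m) ≠ 0 := by
    have : Fact (1 < m) := ⟨hm2⟩
    exact one_ne_zero
  obtain ⟨S, hS⟩ := eventually_atTop.1 (hgrow (b i₀ / 2) (by positivity) (2 / h))
  set s := 2 * max S 1 + 2 * |r| with hs
  have hS1 : S ≤ max S 1 := le_max_left _ _
  have h11 : 1 ≤ max S 1 := le_max_right _ _
  have hr := le_abs_self r
  have hr0 := abs_nonneg r
  have hspos : 0 < s := by linarith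
  refine ⟨s, hspos, by linarith, ?_⟩
  set u : ZMod m → ℝ := Pi.single i₀ s with hu
  have hui : u i₀ = s := by simp [hu]
  have hun : ∀ i, i ≠ i₀ → u i = 0 := fun i hi => by simp [hu, hi]
  -- only two increments are nonzero
  have hsum1 : ∑ i, potential φ ((u (i + 1) - u i) / h)
      = potential φ (-s / h) + potential φ (s / h) := by
    rw [Fintype.sum_eq_add i₀ (i₀ - 1) (fun hc => hone (by
      have : i₀ + 1 = i₀ := by rw [eq_sub_iff_add_eq] at hc; exact hc
      simpa using this))]
    · rw [hui, hun (i₀ + 1) (by simpa using hone), sub_add_cancel, hui,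
        hun (i₀ - 1) (by simpa using hone)]
      simp
    · rintro i ⟨h1, h2⟩
      rw [hun i h1, hun (i + 1) (fun hc => h2 (eq_sub_of_add_eq hc))]
      simp
  have hsum2 : ∑ i, potential (nodeForce (b i) f) (u i) = potential (nodeForce (b i₀) f) s := by
    rw [Fintype.sum_eq_single i₀ fun i hi => by rw [hun i hi, potential_zero], hui]
  have hE : energy h φ (fun i => nodeForce (b i) f) u
      = h * (potential φ (-s / h) + potential φ (s / h)) - potential (nodeForce (b i₀) f) s := by
    rw [energy, Finset.sum_sub_distrib, hsum2, ← Finset.mul_sum, hsum1]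
  rw [hE]
  have hp1 := hm.potential_le_mul hφ (-s / h)
  have hp2 := hm.potential_le_mul hφ (s / h)
  have hw := continuous_nodeForce hf (b i₀)
  -- the second half of the interval already contributes enough
  have hW : (s / 2) * (2 * (φ (s / h) - φ (-s / h))) ≤ potential (nodeForce (b i₀) f) s := by
    have hsplit : potential (nodeForce (b i₀) f) s
        = (∫ t in (0 : ℝ)..(s / 2), nodeForce (b i₀) f t) +
          ∫ t in (s / 2)..s, nodeForce (b i₀) f t :=
      (intervalIntegral.integral_add_adjacent_intervals (hw.intervalIntegrable _ _)
        (hw.intervalIntegrable _ _)).symm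
    have hnn : 0 ≤ ∫ t in (0 : ℝ)..(s / 2), nodeForce (b i₀) f t := by
      refine intervalIntegral.integral_nonneg (by positivity) fun t ht => ?_
      have := mul_nonneg hb.le (hfnn t)
      have := min_le_right t 0
      simp only [nodeForce]
      linarith
    have hge : (s / 2) * (2 * (φ (s / h) - φ (-s / h))) ≤
        ∫ t in (s / 2)..s, nodeForce (b i₀) f t := by
      have hconst : ∫ _t in (s / 2)..s, (2 * (φ (s / h) - φ (-s / h)))
          = (s / 2) * (2 * (φ (s / h) - φ (-s / h))) := by
        rw [intervalIntegral.integral_const, smul_eq_mul]; ring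
      rw [← hconst]
      refine intervalIntegral.integral_mono_on (by linarith) (intervalIntegrable_const)
        (hw.intervalIntegrable _ _) fun t ht => ?_
      have h1 := hS t (by linarith [ht.1])
      have h2 : φ (s / h) ≤ φ (2 / h * t) := hm (by
        rw [div_mul_eq_mul_div]
        exact div_le_div_of_nonneg_right (by linarith [ht.1]) hh.le)
      have h3 : φ (-(2 / h * t)) ≤ φ (-s / h) := hm (by
        rw [div_mul_eq_mul_div, ← neg_div]
        exact div_le_div_of_nonneg_right (by linarith [ht.1]) hh.le)
      have := min_le_right t 0
      simp only [nodeForce]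
      linarith
    linarith
  have h1 : h * (potential φ (-s / h) + potential φ (s / h))
      ≤ h * (φ (-s / h) * (-s / h) + φ (s / h) * (s / h)) := by gcongr
  have h2 : h * (φ (-s / h) * (-s / h) + φ (s / h) * (s / h)) = s * (φ (s / h) - φ (-s / h)) := by
    field_simp
    ring
  linarith

/-- Solutions of the discrete problem above a mountain range. -/
theorem exists_discrete_solution [NeZero m] (hm2 : 2 ≤ m) (hh : 0 < h) (hφ : Continuous φ)
    (hm : Monotone φ)
    (hf : Continuous f) (hfnn : ∀ s, 0 ≤ f s) (hf0 : ∀ s ≤ 0, f s = 0)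
    (hb : ∀ i, b i ≠ 0) (hbpos : ∃ i, 0 < b i)
    (hgrow : ∀ ε > 0, ∀ K : ℝ, ∀ᶠ s in atTop, 1 + φ (K * s) - φ (-(K * s)) < ε * f s)
    {r c : ℝ} (hr : 0 < r) (hc : 0 < c)
    (hbar : ∀ u : ZMod m → ℝ, (∀ i, u i ≤ r) → (∃ i, u i = r) →
      c ≤ energy h φ (fun i => nodeForce (b i) f) u) :
    ∃ u : ZMod m → ℝ, (∀ i, 0 ≤ u i) ∧
      (∀ i, φ ((u (i + 1) - u i) / h) - φ ((u i - u (i - 1)) / h) = -(b i * f (u i))) ∧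
      c ≤ energy h φ (fun i => nodeForce (b i) f) u := by
  obtain ⟨i₀, hi₀⟩ := hbpos
  obtain ⟨R, hR⟩ := exists_le_norm_energyGrad hh hm hf0 hb hgrow
  obtain ⟨s, hs0, hrs, hs⟩ := exists_energy_single_neg hm2 hh hφ hm hf hfnn hi₀ hgrow r
  have hw : ∀ i, Continuous (nodeForce (b i) f) := fun i => continuous_nodeForce hf (b i)
  have hqc : Continuous fun u : ZMod m → ℝ => Finset.univ.sup' Finset.univ_nonempty u :=
    Continuous.finset_sup'_apply _ fun i _ => continuous_apply i
  obtain ⟨u, hDu, hcu⟩ := exists_critical_of_barrier (continuous_energy hφ hw)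
    (continuous_energyGrad hφ hw) (hasDerivAt_energy hh.ne' hφ hw) one_pos hR hqc
    (r := r) (c := c) (e := Pi.single i₀ s)
    (by
      rw [Finset.sup'_lt_iff]
      exact fun i _ => hr)
    (by simpa [energy] using hc)
    (by
      rw [Finset.lt_sup'_iff]
      exact ⟨i₀, Finset.mem_univ _, by simpa using hrs⟩)
    (hs.trans_lt hc)
    (fun u hu => by
      obtain ⟨i, -, hi⟩ := Finset.exists_mem_eq_sup' Finset.univ_nonempty u
      exact hbar u (fun j => (Finset.le_sup' u (Finset.mem_univ j)).trans hu.le)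
        ⟨i, hi.symm.trans hu⟩)
  have hnn : ∀ i, 0 ≤ u i := by
    obtain ⟨i, hi⟩ := exists_forall_ge_node u
    intro j
    refine le_trans ?_ (hi j)
    by_contra! hneg
    have := energyGrad_le_of_min (b := b) hh hm hf0 hi hneg.le
    rw [hDu, Pi.zero_apply] at this
    linarith
  refine ⟨u, hnn, fun i => ?_, hcu⟩
  have := congrFun hDu i
  simp only [energyGrad, nodeForce, min_eq_right (hnn i), Pi.zero_apply] at this
  linarith

end

/-- A nonnegative discrete solution which starts at its maximum `M` and is concave over a long
stretch cannot have a large weight there. -/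
theorem discrete_weight_le {φ f : ℝ → ℝ} {U β : ℕ → ℝ} {h ℓ M Γ A : ℝ} {k : ℕ} (hh : 0 < h)
    (hℓ : 0 < ℓ) (hm : StrictMono φ) (h0 : φ 0 = 0) (hkh : ℓ ≤ k * h) (hU0 : U 0 = M)
    (hUM : ∀ j, U j ≤ M) (hUnn : ∀ j, 0 ≤ U j)
    (heq : ∀ j < 2 * k, φ ((U (j + 2) - U (j + 1)) / h) - φ ((U (j + 1) - U j) / h)
      = -(β (j + 1) * f (U (j + 1))))
    (hβ : ∀ j < 2 * k, 0 ≤ β (j + 1)) (hf : ∀ s, 0 ≤ f s) (hΓ : ∀ s, M / 2 ≤ s → s ≤ M → Γ ≤ f s)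
    (hA : A ≤ ∑ j ∈ Finset.range k, β (j + 1)) (hΓ0 : 0 ≤ Γ) :
    A * Γ ≤ -φ (-(M / ℓ)) := by
  set d : ℕ → ℝ := fun j => (U (j + 1) - U j) / h with hd
  have hstep : ∀ j, U (j + 1) - U j = h * d j := fun j => by simp only [hd]; field_simp
  have hdec : ∀ j < 2 * k, d (j + 1) ≤ d j := fun j hj => by
    have := heq j hj
    have := mul_nonneg (hβ j hj) (hf (U (j + 1)))
    exact hm.le_iff_le.1 (by simp only [hd]; linarith)
  have hanti : ∀ i j, i ≤ j → j ≤ 2 * k → d j ≤ d i := by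
    intro i j hij
    induction j, hij using Nat.le_induction with
    | base => exact fun _ => le_rfl
    | succ n hn ih => exact fun hj => (hdec n (by omega)).trans (ih (by omega))
  have hdiff : ∀ i n, U (i + n) - U i = h * ∑ l ∈ Finset.range n, d (i + l) := by
    intro i n
    induction n with
    | zero => simp
    | succ n ih =>
      rw [Finset.sum_range_succ, mul_add, ← ih, ← hstep, ← add_assoc]
      ring
  have hhalf : ∀ j ≤ k, M / 2 ≤ U j := by
    intro j hj
    have h1 := hdiff 0 j
    have h2 := hdiff j j
    have h3 : ∑ l ∈ Finset.range j, d (j + l) ≤ ∑ l ∈ Finset.range j, d (0 + l) :=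
      Finset.sum_le_sum fun l hl => hanti _ _ (by omega)
        (by have := Finset.mem_range.1 hl; omega)
    have h4 := mul_le_mul_of_nonneg_left h3 hh.le
    rw [zero_add] at h1
    linarith [hUnn (j + j)]
  have hφk : φ (d k) ≤ -(A * Γ) := by
    have hsum : φ (d k) - φ (d 0) = ∑ j ∈ Finset.range k, (φ (d (j + 1)) - φ (d j)) :=
      (Finset.sum_range_sub (fun j => φ (d j)) k).symm
    have h1 : ∑ j ∈ Finset.range k, (φ (d (j + 1)) - φ (d j))
        ≤ ∑ j ∈ Finset.range k, -(β (j + 1) * Γ) := by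
      refine Finset.sum_le_sum fun j hj => ?_
      have hjk := Finset.mem_range.1 hj
      have h2 := heq j (by omega)
      have h3 := mul_le_mul_of_nonneg_left (hΓ _ (hhalf (j + 1) (by omega)) (hUM _))
        (hβ j (by omega))
      simp only [hd]
      linarith
    rw [Finset.sum_neg_distrib, ← Finset.sum_mul] at h1
    have h2 := mul_le_mul_of_nonneg_right hA hΓ0
    have h3 : φ (d 0) ≤ 0 := by
      rw [← h0]
      refine hm.monotone (div_nonpos_of_nonpos_of_nonneg ?_ hh.le)
      linarith [hUM (0 + 1)]
    linarith
  have hk0 : (0 : ℝ) < k := by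
    by_contra! hc
    nlinarith
  have hdk : -(M / ℓ) ≤ d k := by
    have h1 := hdiff k k
    have h2 : ∑ l ∈ Finset.range k, d (k + l) ≤ ∑ l ∈ Finset.range k, d k :=
      Finset.sum_le_sum fun l hl => hanti _ _ (by omega)
        (by have := Finset.mem_range.1 hl; omega)
    rw [Finset.sum_const, Finset.card_range, nsmul_eq_mul] at h2
    have h3 := mul_le_mul_of_nonneg_left h2 hh.le
    have h4 : -M ≤ (k * h) * d k := by linarith [hUnn (k + k), hUM k]
    rw [← neg_div, div_le_iff₀ hℓ]
    rcases le_total 0 (d k) with h5 | h5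
    · have : 0 ≤ M := by rw [← hU0]; exact hUnn 0
      nlinarith [mul_nonneg h5 hℓ.le]
    · nlinarith
  have := hm.monotone hdk
  linarith

theorem potential_nodeForce_le {f : ℝ → ℝ} (hf : Continuous f) (b s : ℝ) :
    potential (nodeForce b f) s ≤ b * potential f s := by
  have hc : Continuous fun t : ℝ => min t 0 := by fun_prop
  have h1 : potential (nodeForce b f) s = b * potential f s - potential (fun t => min t 0) s := by
    simp only [potential, nodeForce]
    rw [intervalIntegral.integral_sub ((hf.intervalIntegrable _ _).const_mul _)
      (hc.intervalIntegrable _ _), intervalIntegral.integral_const_mul]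
  have h2 := Monotone.potential_nonneg (φ := fun t => min t 0) hc
    (fun x y hxy => min_le_min_right 0 hxy) (min_self 0) s
  linarith

theorem monotone_potential {f : ℝ → ℝ} (hf : Continuous f) (hnn : ∀ s, 0 ≤ f s) :
    Monotone (potential f) :=
  monotone_of_hasDerivAt_nonneg (fun x => hasDerivAt_potential hf x) hnn

theorem potential_sub_potential {f : ℝ → ℝ} (hf : Continuous f) (x y : ℝ) :
    potential f y - potential f x = ∫ s in x..y, f s :=
  intervalIntegral.integral_interval_sub_left (hf.intervalIntegrable _ _)
    (hf.intervalIntegrable _ _)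

/-- A sum over an arc of a cyclic grid is at most the sum over the whole grid. -/
theorem sum_range_le_sum_zmod {m : ℕ} [NeZero m] {F : ZMod m → ℝ} (hF : ∀ i, 0 ≤ F i)
    (i : ZMod m) {n : ℕ} (hn : n ≤ m) : ∑ l ∈ Finset.range n, F (i + l) ≤ ∑ j, F j := by
  have hinj : Set.InjOn (fun l : ℕ => i + (l : ZMod m)) (Finset.range n) := by
    intro x hx y hy hxy
    have h1 : (x : ZMod m) = y := add_left_cancel hxy
    rw [ZMod.natCast_eq_natCast_iff'] at h1
    have := Finset.mem_range.1 hx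
    have := Finset.mem_range.1 hy
    rwa [Nat.mod_eq_of_lt (by omega), Nat.mod_eq_of_lt (by omega)] at h1
  rw [← Finset.sum_image (f := F) hinj]
  exact Finset.sum_le_sum_of_subset_of_nonneg (Finset.subset_univ _) fun j _ _ => hF j

/-- The kinetic part of the discrete energy controls the oscillation. -/
theorem mul_sub_le_sum_potential {m : ℕ} [NeZero m] {h T y : ℝ} {φ : ℝ → ℝ} (hh : 0 < h)
    (hT : m * h = T) (hφ : Continuous φ) (hm : Monotone φ) (h0 : φ 0 = 0) (hy : 0 ≤ y)
    (u : ZMod m → ℝ) (i j : ZMod m) :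
    φ y * (u j - u i - T * y) ≤ ∑ l, h * potential φ ((u (l + 1) - u l) / h) := by
  refine le_trans ?_ (sum_range_le_sum_zmod
    (F := fun l => h * potential φ ((u (l + 1) - u l) / h))
    (fun l => mul_nonneg hh.le (hm.potential_nonneg hφ h0 _)) i (ZMod.val_lt (j - i)).le)
  have hφy : 0 ≤ φ y := h0 ▸ hm hy
  have h1 : ∀ l ∈ Finset.range (j - i).val, φ y * ((u (i + (l + 1 : ℕ)) - u (i + l)) - h * y)
      ≤ h * potential φ ((u (i + l + 1) - u (i + l)) / h) := by
    intro l _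
    have := mul_le_mul_of_nonneg_left
      (hm.mul_sub_le_potential hφ h0 ((u (i + l + 1) - u (i + l)) / h) y) hh.le
    refine le_trans (le_of_eq ?_) this
    push_cast
    rw [add_assoc]
    field_simp
  refine le_trans ?_ (Finset.sum_le_sum h1)
  rw [← Finset.mul_sum, Finset.sum_sub_distrib,
    Finset.sum_range_sub (fun l : ℕ => u (i + (l : ZMod m))), Finset.sum_const, Finset.card_range,
    nsmul_eq_mul]
  have h2 : i + ((j - i).val : ZMod m) = j := by
    rw [ZMod.natCast_zmod_val]; ring
  have h3 : ((j - i).val : ℝ) * (h * y) ≤ T * y := by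
    rw [← hT, mul_assoc]
    have : ((j - i).val : ℝ) ≤ m := by exact_mod_cast (ZMod.val_lt (j - i)).le
    exact mul_le_mul_of_nonneg_right this (by positivity)
  rw [h2]
  refine mul_le_mul_of_nonneg_left ?_ hφy
  simp only [Nat.cast_zero, add_zero]
  linarith

/-- The mountain range around the origin, uniformly in the mesh of the grid. -/
theorem exists_energy_barrier {T B κ : ℝ} {φ f : ℝ → ℝ} (hT : 0 < T) (hB : 0 ≤ B) (hκ : 0 < κ)
    (hφ : Continuous φ) (hm : StrictMono φ) (h0 : φ 0 = 0)
    (hf : Continuous f) (hf0 : ∀ s ≤ 0, f s = 0) (hfpos : ∀ s, 0 < s → 0 < f s)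
    (hσ : ∀ K : ℝ, 1 < K → ∃ C, ∀ᶠ s in nhdsWithin 0 (Ioi (0 : ℝ)), φ (K * s) ≤ C * φ s)
    (hosc : ∃ η₀ : ℝ, 0 < η₀ ∧ η₀ < 1 ∧ ∀ᶠ s in nhdsWithin 0 (Ioi (0 : ℝ)),
      ∀ ω ∈ Icc (1 - η₀) 1, f s / 2 ≤ f (ω * s) ∧ f (ω * s) ≤ 2 * f s)
    (hsmall : ∀ ε > 0, ∀ᶠ s in nhdsWithin 0 (Ioi (0 : ℝ)), f s ≤ ε * φ s) :
    ∃ r c : ℝ, 0 < r ∧ 0 < c ∧ ∀ (m : ℕ) [NeZero m] (h : ℝ) (b : ZMod m → ℝ), m * h = T →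
      ∑ i, |b i| ≤ B → ∑ i, b i ≤ -κ → ∀ u : ZMod m → ℝ, (∀ i, u i ≤ r) → (∃ i, u i = r) →
      c ≤ energy h φ (fun i => nodeForce (b i) f) u := by
  obtain ⟨η₀, hη₀, hη₁, hosc⟩ := hosc
  obtain ⟨η, hη, hηη₀, hηT, hηB⟩ : ∃ η : ℝ, 0 < η ∧ η ≤ η₀ ∧ η ≤ T ∧ B * (4 * η / η₀) ≤ κ / 2 := by
    refine ⟨min (min η₀ T) (κ * η₀ / (8 * (B + 1))), by positivity,
      (min_le_left _ _).trans (min_le_left _ _), (min_le_left _ _).trans (min_le_right _ _), ?_⟩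
    have h1 := min_le_right (min η₀ T) (κ * η₀ / (8 * (B + 1)))
    have h2 : B * (4 * (κ * η₀ / (8 * (B + 1))) / η₀) ≤ κ / 2 := by
      have : B * (4 * (κ * η₀ / (8 * (B + 1))) / η₀) = κ / 2 * (B / (B + 1)) := by
        field_simp; ring
      rw [this]
      exact mul_le_of_le_one_right (by positivity) (by rw [div_le_one (by positivity)]; linarith)
    refine le_trans ?_ h2
    gcongr
  set K : ℝ := 2 * T / η with hK
  have hK1 : 1 < K := by rw [hK, one_lt_div hη]; linarith
  obtain ⟨C, hC⟩ := hσ K hK1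
  set C' : ℝ := |C| + 1 with hC'
  have hC'pos : 0 < C' := by positivity
  set ε : ℝ := η / (4 * (B + 1) * C') with hε
  have hεpos : 0 < ε := by positivity
  obtain ⟨s₀, hs₀, hev⟩ := mem_nhdsGT_iff_exists_Ioo_subset.1 (hC.and (hosc.and (hsmall ε hεpos)))
  have hs₀ : 0 < s₀ := hs₀
  set r := s₀ / 2 with hr
  have hrpos : 0 < r := by positivity
  set y := r / K with hy
  have hypos : 0 < y := by positivity
  have hyr : y ≤ r := div_le_self hrpos.le hK1.le
  have hφy : 0 < φ y := h0 ▸ hm hypos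
  have hφr : φ r ≤ C' * φ y := by
    have h1 := (hev (show y ∈ Ioo 0 s₀ from ⟨hypos, by linarith⟩)).1
    rw [hy, mul_div_cancel₀ _ (by positivity)] at h1
    refine h1.trans (mul_le_mul_of_nonneg_right ?_ hφy.le)
    linarith [le_abs_self C]
  have hfnn : ∀ s, 0 ≤ f s := fun s => by
    rcases le_or_gt s 0 with h | h
    · exact (hf0 s h).ge
    · exact (hfpos s h).le
  have hFmono := monotone_potential hf hfnn
  have hFneg : ∀ s ≤ 0, potential f s = 0 := fun s hs => by
    rw [potential, intervalIntegral.integral_symm,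
      intervalIntegral.integral_congr (g := fun _ => 0) fun t ht => hf0 t ?_]
    · simp
    · rw [uIcc_of_le hs] at ht
      exact ht.2
  have hFnn : ∀ s, 0 ≤ potential f s := fun s => by
    rcases le_total s 0 with h | h
    · exact (hFneg s h).ge
    · simpa using hFmono h
  have hosc_r := (hev (show r ∈ Ioo 0 s₀ from ⟨hrpos, by linarith⟩)).2.1
  have hdilate : ∀ t ∈ Icc ((1 - η₀) * r) r, f r / 2 ≤ f t ∧ f t ≤ 2 * f r := by
    intro t ht
    have := hosc_r (t / r) ⟨by rw [le_div_iff₀ hrpos]; exact ht.1,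
      by rw [div_le_one hrpos]; exact ht.2⟩
    rwa [div_mul_cancel₀ _ hrpos.ne'] at this
  have hfr := hfpos r hrpos
  -- lower bound for the primitive at `r`
  have hFr : η₀ * r * (f r / 2) ≤ potential f r := by
    have h1 := potential_sub_potential hf ((1 - η₀) * r) r
    have h2 : ∫ _t in ((1 - η₀) * r)..r, f r / 2 ≤ ∫ t in ((1 - η₀) * r)..r, f t :=
      intervalIntegral.integral_mono_on (by nlinarith) intervalIntegrable_const
        (hf.intervalIntegrable _ _) fun t ht => (hdilate t ht).1
    rw [intervalIntegral.integral_const, smul_eq_mul] at h2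
    have h3 := hFnn ((1 - η₀) * r)
    nlinarith
  have hFrpos : 0 < potential f r := lt_of_lt_of_le (by positivity) hFr
  have hFdiff : potential f r - potential f ((1 - η) * r) ≤ 4 * η / η₀ * potential f r := by
    have h1 := potential_sub_potential hf ((1 - η) * r) r
    have h2 : ∫ t in ((1 - η) * r)..r, f t ≤ ∫ _t in ((1 - η) * r)..r, 2 * f r :=
      intervalIntegral.integral_mono_on (by nlinarith) (hf.intervalIntegrable _ _)
        intervalIntegrable_const fun t ht => (hdilate t ⟨by
          refine le_trans ?_ ht.1
          exact mul_le_mul_of_nonneg_right (by linarith) hrpos.le, ht.2⟩).2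
    rw [intervalIntegral.integral_const, smul_eq_mul] at h2
    have h3 : 4 * η / η₀ * (η₀ * r * (f r / 2)) = (r - (1 - η) * r) * (2 * f r) := by
      field_simp; ring
    have h4 := mul_le_mul_of_nonneg_left hFr (show 0 ≤ 4 * η / η₀ by positivity)
    linarith
  have hFr_le : potential f r ≤ ε * C' * φ y * r := by
    have h2 : ∫ t in (0 : ℝ)..r, f t ≤ ∫ _t in (0 : ℝ)..r, ε * C' * φ y := by
      refine intervalIntegral.integral_mono_on hrpos.le (hf.intervalIntegrable _ _)
        intervalIntegrable_const fun t ht => ?_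
      rcases ht.1.eq_or_lt with h | h
      · rw [← h, hf0 0 le_rfl]; positivity
      · have h5 := (hev (show t ∈ Ioo 0 s₀ from ⟨h, by linarith [ht.2]⟩)).2.2
        have h6 := (hm.monotone ht.2).trans hφr
        rw [mul_assoc]
        exact h5.trans (mul_le_mul_of_nonneg_left h6 hεpos.le)
    rw [intervalIntegral.integral_const, smul_eq_mul] at h2
    rw [potential]
    linarith
  refine ⟨r, min (φ y * (η * r) / 4) (κ / 2 * potential f r), hrpos, by positivity, ?_⟩
  intro m _ h b hmh hbB hbκ u hur hu
  obtain ⟨j, hj⟩ := hu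
  have hh : 0 < h := by
    by_contra! hc
    have : (m : ℝ) * h ≤ 0 := mul_nonpos_of_nonneg_of_nonpos (Nat.cast_nonneg _) hc
    linarith
  have hE : ∑ l, h * potential φ ((u (l + 1) - u l) / h) - ∑ i, b i * potential f (u i)
      ≤ energy h φ (fun i => nodeForce (b i) f) u := by
    rw [energy, ← Finset.sum_sub_distrib]
    exact Finset.sum_le_sum fun i _ => sub_le_sub_left (potential_nodeForce_le hf _ _) _
  by_cases hcase : ∃ i, u i ≤ (1 - η) * r
  · obtain ⟨i, hi⟩ := hcase
    refine (min_le_left _ _).trans (le_trans ?_ hE)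
    have h1 := mul_sub_le_sum_potential hh hmh hφ hm.monotone h0 hypos.le u i j
    have hTy : T * y = η * r / 2 := by rw [hy, hK]; field_simp
    have h2 : φ y * (η * r / 2) ≤ φ y * (u j - u i - T * y) := by
      refine mul_le_mul_of_nonneg_left ?_ hφy.le
      rw [hTy, hj]
      linarith
    have h3 : ∑ i, b i * potential f (u i) ≤ B * potential f r := by
      refine le_trans (Finset.sum_le_sum (g := fun i => |b i| * potential f r) fun i _ => ?_) ?_
      · exact (mul_le_mul_of_nonneg_right (le_abs_self _) (hFnn _)).trans
          (mul_le_mul_of_nonneg_left (hFmono (hur i)) (abs_nonneg _))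
      · rw [← Finset.sum_mul]
        exact mul_le_mul_of_nonneg_right hbB hFrpos.le
    have h4 : B * potential f r ≤ φ y * (η * r) / 4 := by
      have h5 : (B + 1) * (ε * C' * φ y * r) = φ y * (η * r) / 4 := by
        rw [hε]; field_simp
      rw [← h5]
      exact mul_le_mul (by linarith) hFr_le hFrpos.le (by linarith)
    linarith
  · push Not at hcase
    refine (min_le_right _ _).trans (le_trans ?_ hE)
    have h1 : 0 ≤ ∑ l, h * potential φ ((u (l + 1) - u l) / h) :=
      Finset.sum_nonneg fun l _ => mul_nonneg hh.le (hm.monotone.potential_nonneg hφ h0 _)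
    have h2 : ∑ i, b i * potential f (u i) ≤
        ∑ i, (b i * potential f r + |b i| * (4 * η / η₀ * potential f r)) := by
      refine Finset.sum_le_sum fun i _ => ?_
      have h3 : potential f r - potential f (u i) ≤ 4 * η / η₀ * potential f r :=
        (sub_le_sub_left (hFmono (hcase i).le) _).trans hFdiff
      have h4 := sub_nonneg.2 (hFmono (hur i))
      have h5 := mul_le_mul_of_nonneg_left h3 (abs_nonneg (b i))
      have h6 := mul_le_mul_of_nonneg_right (neg_abs_le (b i)) h4
      linarith
    rw [Finset.sum_add_distrib, ← Finset.sum_mul, ← Finset.sum_mul] at h2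
    have h3 := mul_le_mul_of_nonneg_right hbκ hFrpos.le
    have h4 := mul_le_mul_of_nonneg_right hbB
      (show 0 ≤ 4 * η / η₀ * potential f r by positivity)
    have h5 := mul_le_mul_of_nonneg_right hηB hFrpos.le
    linarith

/-- The symmetric spread `φ x - φ (-x)` of `φ`. -/
def spread (φ : ℝ → ℝ) (x : ℝ) : ℝ := φ x - φ (-x)

/-- A globally defined force that agrees with `g` on `[0, 1]`, vanishes on the negative axis and
outgrows all dilations of `φ` at infinity. -/
def truncForce (φ g : ℝ → ℝ) (s : ℝ) : ℝ :=
  g (max 0 (min s 1)) + max (s - 1) 0 * spread φ (s ^ 2)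

section

variable {φ g : ℝ → ℝ}

theorem continuous_spread (hφ : Continuous φ) : Continuous (spread φ) := by
  unfold spread; fun_prop

theorem strictMono_spread (hm : StrictMono φ) : StrictMono (spread φ) := fun x y hxy => by
  have h1 := hm hxy
  have h2 := hm (neg_lt_neg hxy)
  simp only [spread]; linarith

theorem spread_zero : spread φ 0 = 0 := by simp [spread]

theorem spread_pos (hm : StrictMono φ) {x : ℝ} (hx : 0 < x) : 0 < spread φ x :=
  spread_zero (φ := φ) ▸ strictMono_spread hm hx

theorem spread_nonneg (hm : StrictMono φ) {x : ℝ} (hx : 0 ≤ x) : 0 ≤ spread φ x :=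
  spread_zero (φ := φ) ▸ (strictMono_spread hm).monotone hx

theorem continuous_truncForce (hφ : Continuous φ) (hg : ContinuousOn g (Ici 0)) :
    Continuous (truncForce φ g) := by
  have h1 : Continuous fun s : ℝ => g (max 0 (min s 1)) :=
    hg.comp_continuous (by fun_prop) fun s => mem_Ici.2 (le_max_left _ _)
  have h2 : Continuous fun s : ℝ => max (s - 1) 0 := by fun_prop
  exact h1.add (h2.mul ((continuous_spread hφ).comp (continuous_pow 2)))

theorem truncForce_of_nonpos (hg0 : g 0 = 0) {s : ℝ} (hs : s ≤ 0) : truncForce φ g s = 0 := by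
  simp only [truncForce]
  rw [max_eq_right (by linarith : s - 1 ≤ 0), max_eq_left (by simp [hs]), hg0]; simp

theorem truncForce_eq {s : ℝ} (h0 : 0 ≤ s) (h1 : s ≤ 1) : truncForce φ g s = g s := by
  simp only [truncForce]
  rw [max_eq_right (by linarith : s - 1 ≤ 0), min_eq_left h1, max_eq_right h0]; simp

theorem truncForce_pos (hm : StrictMono φ) (hg : ∀ s, 0 < s → 0 < g s) {s : ℝ} (hs : 0 < s) :
    0 < truncForce φ g s :=
  add_pos_of_pos_of_nonneg (hg _ (lt_max_of_lt_right (lt_min hs one_pos)))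
    (mul_nonneg (le_max_right _ _) (spread_nonneg hm (sq_nonneg s)))

theorem truncForce_nonneg (hm : StrictMono φ) (hg0 : g 0 = 0) (hg : ∀ s, 0 < s → 0 < g s) (s : ℝ) :
    0 ≤ truncForce φ g s := by
  rcases le_or_gt s 0 with h | h
  · exact (truncForce_of_nonpos hg0 h).ge
  · exact (truncForce_pos hm hg h).le

theorem mul_spread_le_truncForce (hg : ∀ s, 0 < s → 0 < g s)
    (hm : StrictMono φ) {s x : ℝ} (hs : 1 ≤ s) (hx : x ≤ s ^ 2) :
    (s - 1) * spread φ x ≤ truncForce φ g s := by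
  have h1 : (s - 1) * spread φ x ≤ max (s - 1) 0 * spread φ (s ^ 2) := by
    rw [max_eq_left (by linarith)]
    exact mul_le_mul_of_nonneg_left ((strictMono_spread hm).monotone hx) (by linarith)
  have h2 : 0 < g (max 0 (min s 1)) := hg _ (lt_max_of_lt_right (lt_min (by linarith) one_pos))
  simp only [truncForce]; linarith

theorem eventually_spread_lt_truncForce (hm : StrictMono φ)
    (hg : ∀ s, 0 < s → 0 < g s) {ε : ℝ} (hε : 0 < ε) (K : ℝ) :
    ∀ᶠ s in atTop, 1 + φ (K * s) - φ (-(K * s)) < ε * truncForce φ g s := by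
  have h1 := spread_pos hm one_pos
  filter_upwards [eventually_ge_atTop 1, eventually_ge_atTop K,
    eventually_ge_atTop (1 + (2 + 1 / spread φ 1) / ε)] with s hs1 hsK hs
  have h2 := mul_spread_le_truncForce (s := s) (x := s ^ 2) hg hm hs1 le_rfl
  have h3 : spread φ 1 ≤ spread φ (s ^ 2) := (strictMono_spread hm).monotone (by nlinarith)
  have h4 : spread φ (K * s) ≤ spread φ (s ^ 2) := (strictMono_spread hm).monotone (by nlinarith)
  have h5 : 2 + 1 / spread φ 1 ≤ ε * (s - 1) := by
    have : (2 + 1 / spread φ 1) / ε ≤ s - 1 := by linarith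
    rwa [div_le_iff₀ hε, mul_comm] at this
  have h6 : 1 ≤ 1 / spread φ 1 * spread φ (s ^ 2) := by
    rw [div_mul_eq_mul_div, le_div_iff₀ h1]; linarith
  have h7 := mul_le_mul_of_nonneg_right h5 (h1.le.trans h3)
  have h8 := mul_le_mul_of_nonneg_left h2 hε.le
  have h9 : spread φ (K * s) = φ (K * s) - φ (-(K * s)) := rfl
  nlinarith

theorem exists_mul_spread_le_truncForce (hφ : Continuous φ) (hm : StrictMono φ)
    (hgc : ContinuousOn g (Ici 0)) (hg : ∀ s, 0 < s → 0 < g s) (K : ℝ) (hK : 0 < K) :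
    ∃ c, 0 < c ∧ ∀ s, 1 / 2 ≤ s → c * spread φ (K * s) ≤ truncForce φ g s := by
  have hc := continuous_truncForce hφ hgc
  set S := max 2 K with hS
  have h2S : 2 ≤ S := le_max_left _ _
  have hKS : K ≤ S := le_max_right _ _
  obtain ⟨s₀, hs₀, hmin⟩ := isCompact_Icc.exists_isMinOn (s := Icc (1 / 2 : ℝ) S)
    ⟨1, by norm_num, by linarith⟩ hc.continuousOn
  have hγ : 0 < truncForce φ g s₀ := truncForce_pos hm hg (by linarith [hs₀.1])
  have hΨ := spread_pos hm (mul_pos hK (by linarith : 0 < S))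
  refine ⟨min 1 (truncForce φ g s₀ / spread φ (K * S)), by positivity, fun s hs => ?_⟩
  have hn := spread_nonneg hm (mul_nonneg hK.le (by linarith : 0 ≤ s))
  rcases le_total s S with h | h
  · have h1 : spread φ (K * s) ≤ spread φ (K * S) :=
      (strictMono_spread hm).monotone (mul_le_mul_of_nonneg_left h hK.le)
    calc _ ≤ truncForce φ g s₀ / spread φ (K * S) * spread φ (K * S) :=
          mul_le_mul (min_le_right _ _) h1 hn (by positivity)
      _ = truncForce φ g s₀ := by field_simp
      _ ≤ _ := hmin ⟨hs, h⟩
  · have h1 := mul_spread_le_truncForce (s := s) (x := K * s) hg hm (by linarith)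
      (by nlinarith)
    refine le_trans ?_ h1
    exact mul_le_mul_of_nonneg_right ((min_le_left _ _).trans (by linarith)) hn

end

/-- Regular oscillation gives two-sided control of `g` on short relative intervals. -/
theorem RegOscZero.eventually_comparable {g : ℝ → ℝ} (hreg : RegOscZero g)
    (hg : ∀ s, 0 < s → 0 < g s) :
    ∃ η₀ : ℝ, 0 < η₀ ∧ η₀ < 1 ∧ ∀ᶠ s in nhdsWithin 0 (Ioi (0 : ℝ)),
      ∀ ω ∈ Icc (1 - η₀) 1, g s / 2 ≤ g (ω * s) ∧ g (ω * s) ≤ 2 * g s := by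
  have h1 := hreg.eventually
    (Icc_mem_nhds (by norm_num : (1 / 2 : ℝ) < 1) (by norm_num : (1 : ℝ) < 2))
  obtain ⟨pa, ha, pb, hb, hab⟩ := eventually_prod_iff.1 h1
  obtain ⟨ε, hε, hball⟩ := Metric.eventually_nhds_iff.1 ha
  refine ⟨min (ε / 2) (1 / 2), by positivity, by
    have := min_le_right (ε / 2) (1 / 2); linarith, ?_⟩
  filter_upwards [hb, self_mem_nhdsWithin] with s hs hs0 ω hω
  have hd : dist ω 1 < ε := by
    have := min_le_left (ε / 2) (1 / 2 : ℝ)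
    rw [Real.dist_eq, abs_sub_lt_iff]
    constructor <;> linarith [hω.1, hω.2]
  have h2 := hab (hball hd) hs
  have h3 := hg s hs0
  simp only [le_div_iff₀ h3, div_le_iff₀ h3] at h2
  exact ⟨by linarith [h2.1], h2.2⟩

theorem intervalIntegral_pos_of_ae_pos {a : ℝ → ℝ} {x y : ℝ} (hi : IntervalIntegrable a volume x y)
    (hxy : x < y) (hpos : ∀ᵐ t ∂volume, t ∈ Icc x y → 0 < a t) : 0 < ∫ t in x..y, a t := by
  rw [intervalIntegral.integral_pos_iff_support_of_nonneg_ae' _ hi]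
  · refine ⟨hxy, lt_of_lt_of_le (b := volume (Ioc x y)) (by simpa using hxy) (measure_mono_ae ?_)⟩
    filter_upwards [hpos] with t ht htI
    exact ⟨(ht ⟨htI.1.le, htI.2⟩).ne', htI⟩
  · rw [uIoc_of_le hxy.le]
    filter_upwards [ae_restrict_mem measurableSet_Ioc, ae_restrict_of_ae hpos] with t ht h
    exact (h ⟨ht.1.le, ht.2⟩).le

/-- On an interval where `a` is a.e. positive, integrals over windows of length at least `ℓ` are
uniformly positive. -/
theorem exists_le_intervalIntegral_of_ae_pos {a : ℝ → ℝ}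
    (hi : ∀ x y, IntervalIntegrable a volume x y) {p q ℓ : ℝ} (hℓ : 0 < ℓ)
    (hpos : ∀ᵐ t ∂volume, t ∈ Icc p q → 0 < a t) :
    ∃ A, 0 < A ∧ ∀ x y, p ≤ x → ℓ ≤ y - x → y ≤ q → A ≤ ∫ t in x..y, a t := by
  have hsub : ∀ x y, p ≤ x → x < y → y ≤ q → 0 < ∫ t in x..y, a t := fun x y hx hxy hy =>
    intervalIntegral_pos_of_ae_pos (hi x y) hxy
      (hpos.mono fun t ht htI => ht ⟨hx.trans htI.1, htI.2.trans hy⟩)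
  rcases lt_or_ge (q - ℓ) p with hlt | hle
  · exact ⟨1, one_pos, fun x y hx hxy hy => by linarith⟩
  have hc : Continuous fun x => ∫ t in x..(x + ℓ), a t := by
    have h1 := intervalIntegral.continuous_primitive hi 0
    have : (fun x => ∫ t in x..(x + ℓ), a t)
        = fun x => (∫ t in (0 : ℝ)..(x + ℓ), a t) - ∫ t in (0 : ℝ)..x, a t := by
      ext x; rw [intervalIntegral.integral_interval_sub_left (hi _ _) (hi _ _)]
    rw [this]
    exact (h1.comp (by fun_prop : Continuous fun x => x + ℓ)).sub h1
  obtain ⟨x₀, hx₀, hmin⟩ := isCompact_Icc.exists_isMinOn ⟨p, left_mem_Icc.2 hle⟩ hc.continuousOn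
  refine ⟨_, hsub x₀ (x₀ + ℓ) hx₀.1 (by linarith) (by linarith [hx₀.2]), fun x y hx hxy hy => ?_⟩
  have h1 : (∫ t in x₀..(x₀ + ℓ), a t) ≤ ∫ t in x..(x + ℓ), a t := hmin ⟨hx, by linarith⟩
  have h2 := intervalIntegral.integral_add_adjacent_intervals (hi x (x + ℓ)) (hi (x + ℓ) y)
  rcases (show x + ℓ ≤ y by linarith).eq_or_lt with h | h
  · rwa [← h]
  · have := hsub (x + ℓ) y (by linarith) h hy
    linarith

theorem intervalIntegral_sub_int_mul {a : ℝ → ℝ} {T : ℝ} (hp : Function.Periodic a T) (k : ℤ)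
    (x y : ℝ) : ∫ t in (x - k * T)..(y - k * T), a t = ∫ t in x..y, a t := by
  rw [← intervalIntegral.integral_comp_sub_right]
  exact intervalIntegral.integral_congr fun t _ => hp.sub_int_mul_eq k

/-- A point to the right or to the left of which every window in a stretch of length `4 ℓ` carries
positive weight, uniformly for windows longer than `ℓ`. -/
def IsWeightPoint (a : ℝ → ℝ) (ℓ A t : ℝ) : Prop :=
  (∀ x y, t ≤ x → x < y → y ≤ t + 4 * ℓ →
    0 < (∫ s in x..y, a s) ∧ (ℓ ≤ y - x → A ≤ ∫ s in x..y, a s)) ∨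
  (∀ x y, t - 4 * ℓ ≤ x → x < y → y ≤ t →
    0 < (∫ s in x..y, a s) ∧ (ℓ ≤ y - x → A ≤ ∫ s in x..y, a s))

theorem SignChanging.ae_nonpos {T : ℝ} (hT : 0 < T) {a : ℝ → ℝ} (haper : Function.Periodic a T)
    {N : ℕ} {σ τ : Fin (N + 1) → ℝ} (h : SignChanging T a N σ τ) :
    ∀ᵐ t ∂volume, (∀ (n : Fin (N + 1)) (k : ℤ), t - k * T ∉ Icc (σ n) (τ n)) → a t ≤ 0 := by
  have h1 := h.2.2.2.2
  have h2 : ∀ᵐ t ∂volume, ∀ k : ℤ, t - k * T ∈ Ico (σ 0) (σ 0 + T) \ (⋃ n, Icc (σ n) (τ n)) →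
      a (t - k * T) ≤ 0 := ae_all_iff.2 fun k =>
    (measurePreserving_sub_right volume ((k : ℝ) * T)).quasiMeasurePreserving.ae h1
  filter_upwards [h2] with t ht hn
  obtain ⟨k, hk, -⟩ := existsUnique_sub_zsmul_mem_Ico hT t (σ 0)
  simp only [zsmul_eq_mul] at hk
  rw [← haper.sub_int_mul_eq k]
  exact ht k ⟨hk, fun hmem => by
    obtain ⟨n, hn'⟩ := mem_iUnion.1 hmem
    exact hn n k hn'⟩

theorem SignChanging.exists_weightPoint {T : ℝ} (hT : 0 < T) {a : ℝ → ℝ}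
    (hi : ∀ x y, IntervalIntegrable a volume x y) (haper : Function.Periodic a T)
    {N : ℕ} {σ τ : Fin (N + 1) → ℝ} (h : SignChanging T a N σ τ) :
    ∃ ℓ A : ℝ, 0 < ℓ ∧ 0 < A ∧ ∀ x y, x < y → 0 < (∫ t in x..y, a t) →
      ∃ t ∈ Icc x y, IsWeightPoint a ℓ A t := by
  obtain ⟨n₀, hn₀⟩ := Finite.exists_min fun n => τ n - σ n
  set ℓ := (τ n₀ - σ n₀) / 8 with hℓ
  have hℓ0 : 0 < ℓ := by have := h.1 n₀; simp only [hℓ]; linarith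
  choose A hA0 hA using fun n => exists_le_intervalIntegral_of_ae_pos hi hℓ0 (h.2.2.2.1 n)
  obtain ⟨n₁, hn₁⟩ := Finite.exists_min A
  refine ⟨ℓ, A n₁, hℓ0, hA0 n₁, fun x y hxy hpos => ?_⟩
  obtain ⟨t, ht, n, k, htn⟩ : ∃ t ∈ Icc x y, ∃ n, ∃ k : ℤ, t - k * T ∈ Icc (σ n) (τ n) := by
    by_contra! hno
    have : 0 ≤ ∫ t in x..y, -a t := by
      refine intervalIntegral.integral_nonneg_of_ae_restrict hxy.le ?_
      filter_upwards [ae_restrict_mem measurableSet_Icc, ae_restrict_of_ae (h.ae_nonpos hT haper)]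
        with s hs hs'
      exact neg_nonneg.2 (hs' fun n k => hno s hs n k)
    rw [intervalIntegral.integral_neg] at this
    linarith
  have hwin : ∀ x' y', σ n ≤ x' - k * T → x' < y' → y' - k * T ≤ τ n →
      0 < (∫ s in x'..y', a s) ∧ (ℓ ≤ y' - x' → A n₁ ≤ ∫ s in x'..y', a s) := by
    intro x' y' h1 h2 h3
    rw [← intervalIntegral_sub_int_mul haper k]
    refine ⟨intervalIntegral_pos_of_ae_pos (hi _ _) (by linarith) ?_, fun h4 =>
      (hn₁ n).trans (hA n _ _ h1 (by linarith) h3)⟩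
    filter_upwards [h.2.2.2.1 n] with s hs hsI
    exact hs ⟨h1.trans hsI.1, hsI.2.trans h3⟩
  have hlen : 8 * ℓ ≤ τ n - σ n := by have := hn₀ n; simp only [hℓ]; linarith
  refine ⟨t, ht, ?_⟩
  rcases le_total (t - k * T) ((σ n + τ n) / 2) with hm | hm
  · exact Or.inl fun x' y' h1 h2 h3 => hwin x' y' (by linarith [htn.1]) h2 (by linarith)
  · exact Or.inr fun x' y' h1 h2 h3 => hwin x' y' (by linarith) h2 (by linarith [htn.2])

open Topology in
/-- A uniformly bounded, uniformly Lipschitz sequence of real functions has a pointwise convergent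
subsequence. -/
theorem exists_subseq_tendsto_of_lipschitz {v : ℕ → ℝ → ℝ} {L K : ℝ}
    (hL : ∀ n s t, |v n s - v n t| ≤ L * |s - t|) (hK : ∀ n t, |v n t| ≤ K) :
    ∃ (θ : ℕ → ℕ) (w : ℝ → ℝ), StrictMono θ ∧
      ∀ t, Tendsto (fun j => v (θ j) t) atTop (𝓝 (w t)) := by
  have hcomp : IsCompact (Set.pi univ fun _ : ℚ => Icc (-K) K) :=
    isCompact_univ_pi fun _ => isCompact_Icc
  obtain ⟨z, -, θ, hθ, hz⟩ := hcomp.tendsto_subseq (x := fun n (q : ℚ) => v n q)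
    fun n q _ => abs_le.1 (hK n q)
  rw [tendsto_pi_nhds] at hz
  have hL0 : 0 ≤ L := by
    have := (abs_nonneg _).trans (hL 0 1 0)
    simpa using this
  have hcau : ∀ t, CauchySeq fun j => v (θ j) t := fun t => by
    refine Metric.cauchySeq_iff.2 fun ε hε => ?_
    obtain ⟨q, hq1, hq2⟩ := exists_rat_btwn (show t < t + ε / (3 * (L + 1)) by
      have : 0 < ε / (3 * (L + 1)) := by positivity
      linarith)
    obtain ⟨J, hJ⟩ := Metric.cauchySeq_iff.1 (hz q).cauchySeq (ε / 3) (by positivity)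
    refine ⟨J, fun i hi j hj => ?_⟩
    have h1 : L * |t - q| < ε / 3 := by
      rw [abs_sub_comm, abs_of_pos (by linarith)]
      calc L * (q - t) ≤ (L + 1) * (q - t) := by nlinarith
        _ < (L + 1) * (ε / (3 * (L + 1))) := by
            apply mul_lt_mul_of_pos_left _ (by positivity); linarith
        _ = ε / 3 := by field_simp
    have h2 := hL (θ i) t q
    have h3 := hL (θ j) t q
    have h4 := hJ i hi j hj
    simp only [Function.comp_apply, Real.dist_eq] at h4 ⊢
    rw [abs_le] at h2 h3
    rw [abs_lt] at h4 ⊢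
    constructor <;> linarith [h2.1, h2.2, h3.1, h3.2, h4.1, h4.2]
  choose w hw using fun t => cauchySeq_tendsto_of_complete (hcau t)
  exact ⟨θ, w, hθ, hw⟩

/-- The function that takes the value `G k` on the cell `[k h, (k + 1) h)`. -/
def stepFun (h : ℝ) (G : ℤ → ℝ) (t : ℝ) : ℝ := G ⌊t / h⌋

theorem measurable_stepFun (h : ℝ) (G : ℤ → ℝ) : Measurable (stepFun h G) :=
  (Measurable.of_discrete (f := G)).comp (Int.measurable_floor.comp (measurable_id.div_const h))

theorem stepFun_of_mem_Ioo {h : ℝ} (hh : 0 < h) (G : ℤ → ℝ) {k : ℤ} {t : ℝ}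
    (ht : t ∈ Ioo (k * h) ((k + 1) * h)) : stepFun h G t = G k := by
  have : ⌊t / h⌋ = k := by
    rw [Int.floor_eq_iff, le_div_iff₀ hh, div_lt_iff₀ hh]
    exact ⟨ht.1.le, ht.2⟩
  rw [stepFun, this]

theorem intervalIntegrable_of_measurable_of_bounded {G : ℝ → ℝ} (hG : Measurable G) {C : ℝ}
    (hC : ∀ t, |G t| ≤ C) (x y : ℝ) : IntervalIntegrable G volume x y :=
  (intervalIntegrable_const (c := C)).mono_fun hG.aestronglyMeasurable
    (ae_of_all _ fun t => (hC t).trans (le_abs_self C))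

/-- Integrals over a union of cells telescope. -/
theorem intervalIntegral_cells {F : ℝ → ℝ} (hF : ∀ x y, IntervalIntegrable F volume x y) {h : ℝ}
    {D : ℤ → ℝ} (hcell : ∀ k : ℤ, ∫ s in (k * h)..((k + 1) * h), F s = D (k + 1) - D k) (k : ℤ) :
    ∫ s in (0 : ℝ)..(k * h), F s = D k - D 0 := by
  induction k using Int.induction_on with
  | zero => simp
  | succ k ih =>
    have h1 := intervalIntegral.integral_add_adjacent_intervals (hF 0 (((k : ℤ) : ℝ) * h))
      (hF (((k : ℤ) : ℝ) * h) ((((k : ℤ) : ℝ) + 1) * h))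
    rw [ih, hcell] at h1
    push_cast at h1 ⊢
    linarith
  | pred k ih =>
    have h1 := intervalIntegral.integral_add_adjacent_intervals (hF 0 (((-k - 1 : ℤ) : ℝ) * h))
      (hF (((-k - 1 : ℤ) : ℝ) * h) ((((-k - 1 : ℤ) : ℝ) + 1) * h))
    rw [hcell (-k - 1)] at h1
    have h2 : (((-k - 1 : ℤ) : ℝ) + 1) * h = ((-k : ℤ) : ℝ) * h := by push_cast; ring
    rw [h2, ih, show (-(k : ℤ) - 1 + 1) = -k by ring] at h1
    linarith

section

variable {h E G L : ℝ} {a f ψ : ℝ → ℝ} {U P κ : ℤ → ℝ}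

theorem abs_sub_floor_mul_le (hh : 0 < h) (t : ℝ) : |t - ⌊t / h⌋ * h| ≤ h := by
  have h1 := Int.floor_le (t / h)
  have h2 := Int.lt_floor_add_one (t / h)
  rw [le_div_iff₀ hh] at h1
  rw [div_lt_iff₀ hh] at h2
  rw [abs_of_nonneg (by linarith)]
  linarith

theorem intervalIntegral_comp_stepFun (hh : 0 < h)
    (hψP : ∀ x y, IntervalIntegrable (fun s => ψ (stepFun h P s)) volume x y)
    (hUP : ∀ k, U (k + 1) - U k = h * ψ (P k)) (k : ℤ) :
    ∫ s in (0 : ℝ)..(k * h), ψ (stepFun h P s) = U k - U 0 := by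
  refine intervalIntegral_cells hψP (fun k => ?_) k
  rw [hUP, intervalIntegral.integral_congr_Ioo_of_le (g := fun _ => ψ (P k)) (by linarith)
    fun s hs => by rw [stepFun_of_mem_Ioo hh P hs]]
  rw [intervalIntegral.integral_const]
  simp only [smul_eq_mul]; ring

theorem intervalIntegrable_stepForce (hi : ∀ x y, IntervalIntegrable a volume x y)
    (hf : Continuous f) (hκ : ∀ k, |κ k| ≤ E) (hG : ∀ k, |f (U k)| ≤ G) (x y : ℝ) :
    IntervalIntegrable (fun s => (a s + stepFun h κ s) * f (stepFun h U s)) volume x y := by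
  have h1 : IntervalIntegrable (fun s => a s + stepFun h κ s) volume x y :=
    (hi x y).add (intervalIntegrable_of_measurable_of_bounded (measurable_stepFun h κ)
      (fun t => hκ _) x y)
  have h2 : Measurable fun s => f (stepFun h U s) := hf.measurable.comp (measurable_stepFun h U)
  refine (h1.const_mul G).mono_fun
    (h1.aestronglyMeasurable_restrict_uIoc.mul h2.aestronglyMeasurable) (ae_of_all _ fun s => ?_)
  simp only [norm_mul, Real.norm_eq_abs]
  rw [mul_comm]
  exact mul_le_mul_of_nonneg_right ((hG _).trans (le_abs_self G)) (abs_nonneg _)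

theorem stepFun_eq_sub_intervalIntegral (hh : 0 < h)
    (hi : ∀ x y, IntervalIntegrable a volume x y)
    (hf : Continuous f) (hκ : ∀ k, |κ k| ≤ E) (hG : ∀ k, |f (U k)| ≤ G)
    (hPU : ∀ k : ℤ, P k - P (k - 1) = -((∫ s in (k * h)..((k + 1) * h), (a s + κ k)) * f (U k)))
    (t : ℝ) :
    stepFun h P t = P (-1) - ∫ s in (0 : ℝ)..((⌊t / h⌋ + 1) * h),
      (a s + stepFun h κ s) * f (stepFun h U s) := by
  have h1 := intervalIntegral_cells (D := fun k => -P (k - 1)) (h := h)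
    (intervalIntegrable_stepForce (h := h) hi hf hκ hG) (fun k => ?_) (⌊t / h⌋ + 1)
  · push_cast at h1
    rw [h1, stepFun]
    simp
  · rw [intervalIntegral.integral_congr_Ioo_of_le (g := fun s => (a s + κ k) * f (U k))
      (by linarith) fun s hs => by
        simp only [stepFun_of_mem_Ioo hh κ hs, stepFun_of_mem_Ioo hh U hs]]
    rw [intervalIntegral.integral_mul_const, add_sub_cancel_right]
    linarith [hPU k]

end

/-- A solution with mesh `h` of the discretization of `u' = ψ p`, `p' = -a f(u)`, with values of
`u` in `[0, 1]`, bounds on the data that are uniform in `h`, and weights perturbed by `κ`. -/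
structure GridSolution (T E C r : ℝ) (a f ψ : ℝ → ℝ) (h : ℝ) where
  U : ℤ → ℝ
  P : ℤ → ℝ
  κ : ℤ → ℝ
  U_mem : ∀ k, U k ∈ Icc (0 : ℝ) 1
  abs_P_le : ∀ k, |P k| ≤ C
  abs_κ_le : ∀ k, |κ k| ≤ E * h
  U_step : ∀ k, U (k + 1) - U k = h * ψ (P k)
  P_step : ∀ k : ℤ, P k - P (k - 1) = -((∫ s in (k * h)..((k + 1) * h), (a s + κ k)) * f (U k))
  exists_le : ∃ k : ℤ, 0 ≤ k * h ∧ k * h ≤ T ∧ r ≤ U k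
  periodic : ∃ m : ℤ, m * h = T ∧ ∀ k, U (k + m) = U k

open Topology in
/-- Along a null sequence of meshes for which the step functions and the initial slopes converge,
the limit solves the integral equations. -/
theorem GridSolution.limit {T E C r : ℝ} {a f ψ : ℝ → ℝ}
    (hi : ∀ x y, IntervalIntegrable a volume x y) (hf : Continuous f)
    {h : ℕ → ℝ} (hh : ∀ n, 0 < h n) (hh1 : ∀ n, h n ≤ 1) (hh0 : Tendsto h atTop (𝓝 0))
    (hE : 0 ≤ E)
    (S : ∀ n, GridSolution T E C r a f ψ (h n)) {w : ℝ → ℝ} {p₀ : ℝ}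
    (hw : ∀ t, Tendsto (fun n => stepFun (h n) (S n).U t) atTop (𝓝 (w t)))
    (hp₀ : Tendsto (fun n => (S n).P (-1)) atTop (𝓝 p₀)) :
    ∃ p : ℝ → ℝ, Continuous p ∧ (∀ t, p t = p 0 - ∫ s in (0 : ℝ)..t, a s * f (w s)) ∧
      ∀ t, Tendsto (fun n => stepFun (h n) (S n).P t) atTop (𝓝 (p t)) := by
  obtain ⟨G, hG⟩ := isCompact_Icc.exists_bound_of_continuousOn (s := Icc (0 : ℝ) 1) hf.continuousOn
  have hGU : ∀ n k, |f ((S n).U k)| ≤ G := fun n k => hG _ ((S n).U_mem k)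
  have hG0 : 0 ≤ G := (abs_nonneg _).trans (hGU 0 0)
  have hw01 : ∀ t, w t ∈ Icc (0 : ℝ) 1 := fun t =>
    isClosed_Icc.mem_of_tendsto (hw t) (Eventually.of_forall fun n => (S n).U_mem _)
  have hκE : ∀ n k, |(S n).κ k| ≤ E := fun n k =>
    ((S n).abs_κ_le k).trans (mul_le_of_le_one_right hE (hh1 n))
  set W : ℕ → ℝ → ℝ := fun n s =>
    (a s + stepFun (h n) (S n).κ s) * f (stepFun (h n) (S n).U s) with hW
  have hWi : ∀ n x y, IntervalIntegrable (W n) volume x y := fun n =>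
    intervalIntegrable_stepForce hi hf (hκE n) (hGU n)
  set b : ℝ → ℝ := fun s => G * (|a s| + E) with hb
  have hbi : ∀ x y, IntervalIntegrable b volume x y := fun x y =>
    ((hi x y).abs.add intervalIntegrable_const).const_mul G
  have hWb : ∀ n s, |W n s| ≤ b s := fun n s => by
    have h1 : |stepFun (h n) (S n).κ s| ≤ E := hκE n _
    simp only [hW, hb, abs_mul]
    rw [mul_comm]
    exact mul_le_mul (hGU n _) ((abs_add_le _ _).trans (by linarith)) (abs_nonneg _) hG0
  have hWlim : ∀ s, Tendsto (fun n => W n s) atTop (𝓝 (a s * f (w s))) := fun s => by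
    have h1 : Tendsto (fun n => stepFun (h n) (S n).κ s) atTop (𝓝 0) :=
      squeeze_zero_norm (fun n => (S n).abs_κ_le _) (by simpa using hh0.const_mul E)
    have h2 := (h1.const_add (a s)).mul ((hf.tendsto _).comp (hw s))
    simpa using h2
  have hmain : ∀ t, Tendsto (fun n => ∫ s in (0 : ℝ)..t, W n s) atTop
      (𝓝 (∫ s in (0 : ℝ)..t, a s * f (w s))) := fun t =>
    intervalIntegral.tendsto_integral_filter_of_dominated_convergence b
      (Eventually.of_forall fun n => (hWi n 0 t).aestronglyMeasurable_restrict_uIoc)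
      (Eventually.of_forall fun n => ae_of_all _ fun s _ => hWb n s) (hbi 0 t)
      (ae_of_all _ fun s _ => hWlim s)
  have hend : ∀ t, Tendsto (fun n => ((⌊t / h n⌋ : ℝ) + 1) * h n) atTop (𝓝 t) := fun t => by
    refine tendsto_iff_norm_sub_tendsto_zero.2 (squeeze_zero (fun _ => norm_nonneg _) (fun n => ?_)
      (by simpa using hh0.const_mul 2))
    have h1 := abs_le.1 (abs_sub_floor_mul_le (hh n) t)
    rw [Real.norm_eq_abs, abs_le]
    have := hh n
    constructor <;> linarith [h1.1, h1.2]
  have herr : ∀ t, Tendsto (fun n => ∫ s in t..((⌊t / h n⌋ + 1) * h n), W n s) atTop (𝓝 0) := by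
    intro t
    have h1 := ((intervalIntegral.continuous_primitive hbi t).tendsto t).comp (hend t)
    rw [intervalIntegral.integral_same] at h1
    have h2 := h1.abs
    rw [abs_zero] at h2
    exact squeeze_zero_norm (fun n => intervalIntegral.norm_integral_le_abs_of_norm_le
      (ae_of_all _ (hWb n)) (hbi _ _)) h2
  have hlim : ∀ t, Tendsto (fun n => stepFun (h n) (S n).P t) atTop
      (𝓝 (p₀ - ∫ s in (0 : ℝ)..t, a s * f (w s))) := fun t => by
    have h1 := hp₀.sub ((hmain t).add (herr t))
    rw [add_zero] at h1
    refine h1.congr fun n => ?_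
    rw [stepFun_eq_sub_intervalIntegral (hh n) hi hf (hκE n) (hGU n) (S n).P_step t,
      intervalIntegral.integral_add_adjacent_intervals (hWi n _ _) (hWi n _ _)]
  have hlimi : ∀ x y, IntervalIntegrable (fun s => a s * f (w s)) volume x y := fun x y => by
    refine (hbi x y).mono_fun (aestronglyMeasurable_of_tendsto_ae atTop
      (fun n => (hWi n x y).aestronglyMeasurable_restrict_uIoc) (ae_of_all _ hWlim))
      (ae_of_all _ fun s => ?_)
    simp only [norm_mul, Real.norm_eq_abs, hb]
    rw [abs_of_nonneg hG0, mul_comm, abs_of_nonneg (by positivity : 0 ≤ |a s| + E)]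
    exact mul_le_mul (hG _ (hw01 s)) (by linarith) (abs_nonneg _) hG0
  exact ⟨_, continuous_const.sub (intervalIntegral.continuous_primitive hlimi 0), by simp, hlim⟩

open Topology in
/-- Grid solutions on meshes tending to zero accumulate at a periodic solution of the limit
system. -/
theorem GridSolution.exists_solution {T E C r : ℝ} {a f ψ : ℝ → ℝ}
    (hi : ∀ x y, IntervalIntegrable a volume x y) (hf : Continuous f) (hψ : Continuous ψ)
    {h : ℕ → ℝ} (hh : ∀ n, 0 < h n) (hh1 : ∀ n, h n ≤ 1) (hh0 : Tendsto h atTop (𝓝 0))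
    (hE : 0 ≤ E) (S : ∀ n, GridSolution T E C r a f ψ (h n)) :
    ∃ u p : ℝ → ℝ, Continuous p ∧ Function.Periodic u T ∧ (∀ t, u t ∈ Icc (0 : ℝ) 1) ∧
      (∃ t, r ≤ u t) ∧ (∀ t, HasDerivAt u (ψ (p t)) t) ∧
      ∀ t, p t = p 0 - ∫ s in (0 : ℝ)..t, a s * f (u s) := by
  obtain ⟨L, hL⟩ := isCompact_Icc.exists_bound_of_continuousOn (s := Icc (-C) C) hψ.continuousOn
  have hPL : ∀ n t, |ψ (stepFun (h n) (S n).P t)| ≤ L := fun n t =>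
    hL _ (abs_le.1 ((S n).abs_P_le _))
  have hL0 : 0 ≤ L := (abs_nonneg _).trans (hPL 0 0)
  have hψi : ∀ n x y, IntervalIntegrable (fun s => ψ (stepFun (h n) (S n).P s)) volume x y :=
    fun n => intervalIntegrable_of_measurable_of_bounded
      (hψ.measurable.comp (measurable_stepFun _ _)) (hPL n)
  set v : ℕ → ℝ → ℝ := fun n t => (S n).U 0 + ∫ s in (0 : ℝ)..t, ψ (stepFun (h n) (S n).P s) with hv
  have hvL : ∀ n s t, |v n s - v n t| ≤ L * |s - t| := fun n s t => by
    have h1 : v n s - v n t = ∫ x in t..s, ψ (stepFun (h n) (S n).P x) := by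
      simp only [hv, add_sub_add_left_eq_sub]
      exact intervalIntegral.integral_interval_sub_left (hψi n _ _) (hψi n _ _)
    have h2 : ∀ x ∈ uIoc t s, ‖ψ (stepFun (h n) (S n).P x)‖ ≤ L := fun x _ => hPL n x
    rw [h1]
    exact intervalIntegral.norm_integral_le_of_norm_le_const h2
  have hvU : ∀ n t, |v n t - stepFun (h n) (S n).U t| ≤ L * h n := fun n t => by
    have h1 : v n (⌊t / h n⌋ * h n) = stepFun (h n) (S n).U t := by
      simp only [hv]
      rw [intervalIntegral_comp_stepFun (hh n) (hψi n) (S n).U_step, stepFun]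
      ring
    rw [← h1]
    exact (hvL n _ _).trans (mul_le_mul_of_nonneg_left (abs_sub_floor_mul_le (hh n) t) hL0)
  have hv1 : ∀ n t, |v n t| ≤ 1 + L := fun n t => by
    have h1 := abs_le.1 (hvU n t)
    have h2 : stepFun (h n) (S n).U t ∈ Icc (0 : ℝ) 1 := (S n).U_mem _
    have h3 := mul_le_of_le_one_right hL0 (hh1 n)
    rw [abs_le]
    constructor <;> linarith [h1.1, h1.2, h2.1, h2.2]
  choose k hk0 hkT hkr using fun n => (S n).exists_le
  obtain ⟨⟨p₀, t₀⟩, -, θ₁, hθ₁, hlim₁⟩ := (isCompact_Icc.prod isCompact_Icc).tendsto_subseq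
    (s := Icc (-C) C ×ˢ Icc 0 T) (x := fun n => ((S n).P (-1), (k n : ℝ) * h n))
    fun n => ⟨abs_le.1 ((S n).abs_P_le _), hk0 n, hkT n⟩
  obtain ⟨θ₂, w, hθ₂, hw⟩ := exists_subseq_tendsto_of_lipschitz (v := fun n => v (θ₁ n))
    (fun n => hvL _) (fun n => hv1 _)
  set θ := fun n => θ₁ (θ₂ n) with hθ
  replace hw : ∀ t, Tendsto (fun n => v (θ n) t) atTop (𝓝 (w t)) := hw
  have hθt : Tendsto θ atTop atTop := hθ₁.tendsto_atTop.comp hθ₂.tendsto_atTop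
  have hhθ : Tendsto (fun n => h (θ n)) atTop (𝓝 0) := hh0.comp hθt
  have hwU : ∀ t, Tendsto (fun n => stepFun (h (θ n)) (S (θ n)).U t) atTop (𝓝 (w t)) := fun t => by
    have h1 : Tendsto (fun n => v (θ n) t - stepFun (h (θ n)) (S (θ n)).U t) atTop (𝓝 0) :=
      squeeze_zero_norm (fun n => hvU _ t) (by simpa using hhθ.const_mul L)
    simpa using (hw t).sub h1
  have hlim₂ := hlim₁.comp hθ₂.tendsto_atTop
  obtain ⟨p, hpc, hp, hpP⟩ := GridSolution.limit hi hf (fun n => hh (θ n)) (fun n => hh1 (θ n)) hhθ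
    hE (fun n => S (θ n)) hwU ((continuous_fst.tendsto _).comp hlim₂)
  have hψp : Continuous fun s => ψ (p s) := hψ.comp hpc
  have hwint : ∀ t, w t = w 0 + ∫ s in (0 : ℝ)..t, ψ (p s) := fun t => by
    have h1 : Tendsto (fun n => ∫ s in (0 : ℝ)..t, ψ (stepFun (h (θ n)) (S (θ n)).P s)) atTop
        (𝓝 (∫ s in (0 : ℝ)..t, ψ (p s))) :=
      intervalIntegral.tendsto_integral_filter_of_dominated_convergence (fun _ => L)
        (Eventually.of_forall fun n => (hψi _ 0 t).aestronglyMeasurable_restrict_uIoc)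
        (Eventually.of_forall fun n => ae_of_all _ fun s _ => hPL _ s) intervalIntegrable_const
        (ae_of_all _ fun s _ => (hψ.tendsto _).comp (hpP s))
    refine tendsto_nhds_unique (hw t) (((hw 0).add h1).congr fun n => ?_)
    simp only [hv, intervalIntegral.integral_same, add_zero]
  refine ⟨w, p, hpc, fun t => ?_, fun t => ?_, ⟨t₀, ?_⟩, fun t => ?_, hp⟩
  · refine tendsto_nhds_unique (hwU (t + T)) ((hwU t).congr fun n => ?_)
    obtain ⟨m, hm, hper⟩ := (S (θ n)).periodic
    have h1 : (t + T) / h (θ n) = t / h (θ n) + m := by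
      rw [← hm, add_div, mul_div_cancel_right₀ _ (hh (θ n)).ne']
    rw [stepFun, stepFun, h1, Int.floor_add_intCast, hper]
  · exact isClosed_Icc.mem_of_tendsto (hwU t) (Eventually.of_forall fun n => (S (θ n)).U_mem _)
  · have h1 : Tendsto (fun n => (k (θ n) : ℝ) * h (θ n)) atTop (𝓝 t₀) :=
      (continuous_snd.tendsto _).comp hlim₂
    have h2 : Tendsto (fun n => v (θ n) t₀ + L * |(k (θ n) : ℝ) * h (θ n) - t₀|) atTop
        (𝓝 (w t₀ + L * |t₀ - t₀|)) := (hw t₀).add ((h1.sub_const t₀).abs.const_mul L)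
    rw [sub_self, abs_zero, mul_zero, add_zero] at h2
    refine ge_of_tendsto h2 (Eventually.of_forall fun n => ?_)
    have h3 := abs_le.1 (hvL (θ n) (k (θ n) * h (θ n)) t₀)
    have h4 : v (θ n) (k (θ n) * h (θ n)) = (S (θ n)).U (k (θ n)) := by
      simp only [hv]
      rw [intervalIntegral_comp_stepFun (hh _) (hψi _) (S (θ n)).U_step]
      ring
    linarith [h3.2, hkr (θ n)]
  · have h1 := (hψp.integral_hasStrictDerivAt 0 t).hasDerivAt.const_add (w 0)
    exact h1.congr_of_eventuallyEq (Eventually.of_forall hwint)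

open Topology in
/-- A nonnegative solution that vanishes at a point vanishes on a right neighbourhood of it. -/
theorem eventually_eq_zero_right {φ f ψ a u p : ℝ → ℝ} (hm : StrictMono φ) (h0 : φ 0 = 0)
    (hφψ : ∀ y, φ (ψ y) = y) (hi : ∀ x y, IntervalIntegrable a volume x y) (hf : Continuous f)
    (hfnn : ∀ s, 0 ≤ f s) {δ₀ : ℝ} (hδ₀ : 0 < δ₀) (hfφ : ∀ s, 0 ≤ s → s < δ₀ → f s ≤ φ s)
    (hunn : ∀ t, 0 ≤ u t) (hu : ∀ t, HasDerivAt u (ψ (p t)) t)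
    (hp : ∀ t, p t = p 0 - ∫ s in (0 : ℝ)..t, a s * f (u s)) {t₀ : ℝ} (ht₀ : u t₀ = 0) :
    ∀ᶠ t in 𝓝[>] t₀, u t = 0 := by
  have huc : Continuous u := continuous_iff_continuousAt.2 fun t => (hu t).continuousAt
  have hψ0 : ψ (p t₀) = 0 :=
    IsLocalMin.hasDerivAt_eq_zero (Eventually.of_forall fun t => ht₀ ▸ hunn t) (hu t₀)
  have hp0 : p t₀ = 0 := by rw [← hφψ (p t₀), hψ0, h0]
  have hai : ∀ x y, IntervalIntegrable (fun s => |a s|) volume x y := fun x y => (hi x y).abs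
  have hafi : ∀ x y, IntervalIntegrable (fun s => a s * f (u s)) volume x y := fun x y =>
    (hi x y).mul_continuousOn (hf.comp huc).continuousOn
  have hA : Tendsto (fun t => ∫ s in t₀..t, |a s|) (𝓝 t₀) (𝓝 0) := by
    have := (intervalIntegral.continuous_primitive hai t₀).tendsto t₀
    rwa [intervalIntegral.integral_same] at this
  have hev : ∀ᶠ t in 𝓝 t₀, u t < δ₀ ∧ (∫ s in t₀..t, |a s|) < 1 :=
    ((huc.tendsto t₀).eventually (gt_mem_nhds (ht₀ ▸ hδ₀))).and
      (hA.eventually (gt_mem_nhds one_pos))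
  obtain ⟨δ, hδ, hball⟩ := Metric.eventually_nhds_iff.1 hev
  obtain ⟨d, hd0, hdδ, hd2⟩ : ∃ d, 0 < d ∧ d < δ ∧ d ≤ 1 / 2 :=
    ⟨min (δ / 2) (1 / 2), by positivity, (min_le_left _ _).trans_lt (by linarith), min_le_right _ _⟩
  have hnear : ∀ t ∈ Icc t₀ (t₀ + d), u t < δ₀ ∧ (∫ s in t₀..t, |a s|) < 1 := fun t ht =>
    hball (by rw [Real.dist_eq, abs_of_nonneg (by linarith [ht.1])]; linarith [ht.2])
  obtain ⟨z, hz, hmax⟩ := isCompact_Icc.exists_isMaxOn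
    ⟨t₀, left_mem_Icc.2 (by linarith : t₀ ≤ t₀ + d)⟩ huc.continuousOn
  have hslope : ∀ t ∈ Icc t₀ (t₀ + d), ψ (p t) ≤ u z := by
    intro t ht
    have h1 : p t = ∫ s in t₀..t, -(a s * f (u s)) := by
      have h2 := intervalIntegral.integral_interval_sub_left (hafi 0 t) (hafi 0 t₀)
      rw [intervalIntegral.integral_neg, ← h2]
      linarith [hp t, hp t₀]
    have hφz : 0 ≤ φ (u z) := h0 ▸ hm.monotone (hunn z)
    have h3 : p t ≤ ∫ s in t₀..t, |a s| * φ (u z) := by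
      rw [h1]
      refine intervalIntegral.integral_mono_on ht.1 (hafi _ _).neg ((hai _ _).mul_const _) ?_
      intro s hs
      have hs' : s ∈ Icc t₀ (t₀ + d) := ⟨hs.1, hs.2.trans ht.2⟩
      have h4 : f (u s) ≤ φ (u z) :=
        (hfφ _ (hunn s) (hnear s hs').1).trans (hm.monotone (hmax hs'))
      calc -(a s * f (u s)) ≤ |a s| * f (u s) := by
            rw [← neg_mul]; exact mul_le_mul_of_nonneg_right (neg_le_abs _) (hfnn _)
        _ ≤ _ := mul_le_mul_of_nonneg_left h4 (abs_nonneg _)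
    rw [intervalIntegral.integral_mul_const] at h3
    have h5 : p t ≤ φ (u z) := h3.trans (mul_le_of_le_one_left hφz (hnear t ht).2.le)
    rw [← hφψ (p t)] at h5
    exact hm.le_iff_le.1 h5
  have hz2 : u z - u t₀ ≤ u z * (z - t₀) :=
    (convex_Icc t₀ (t₀ + d)).image_sub_le_mul_sub_of_deriv_le huc.continuousOn
      (fun t _ => (hu t).differentiableAt.differentiableWithinAt)
      (fun t ht => by rw [(hu t).deriv]; exact hslope t (interior_subset ht))
      t₀ (left_mem_Icc.2 (by linarith)) z hz hz.1
  have hz0 : u z ≤ 0 := by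
    have h6 : u z * (z - t₀) ≤ u z * (1 / 2) :=
      mul_le_mul_of_nonneg_left (by linarith [hz.2]) (hunn z)
    linarith
  filter_upwards [Ioc_mem_nhdsGT (by linarith : t₀ < t₀ + d)] with t ht
  exact le_antisymm ((hmax ⟨ht.1.le, ht.2⟩).trans hz0) (hunn t)

/-- Nonnegative, nonzero periodic solutions are positive. -/
theorem pos_of_periodic_solution {T : ℝ} (hT : 0 < T) {φ f ψ a u p : ℝ → ℝ} (hm : StrictMono φ)
    (h0 : φ 0 = 0) (hφψ : ∀ y, φ (ψ y) = y) (hi : ∀ x y, IntervalIntegrable a volume x y)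
    (hf : Continuous f) (hfnn : ∀ s, 0 ≤ f s) {δ₀ : ℝ} (hδ₀ : 0 < δ₀)
    (hfφ : ∀ s, 0 ≤ s → s < δ₀ → f s ≤ φ s) (hper : Function.Periodic u T) (hunn : ∀ t, 0 ≤ u t)
    (hne : ∃ t, 0 < u t) (hu : ∀ t, HasDerivAt u (ψ (p t)) t)
    (hp : ∀ t, p t = p 0 - ∫ s in (0 : ℝ)..t, a s * f (u s)) (t : ℝ) : 0 < u t := by
  refine (hunn t).lt_of_ne fun ht => ?_
  have huc : Continuous u := continuous_iff_continuousAt.2 fun t => (hu t).continuousAt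
  have hsub : Icc t (t + T) ⊆ {x | u x = 0} :=
    IsClosed.Icc_subset_of_forall_mem_nhdsWithin
      ((isClosed_eq huc continuous_const).inter isClosed_Icc) ht.symm fun x hx =>
      eventually_eq_zero_right hm h0 hφψ hi hf hfnn hδ₀ hfφ hunn hu hp hx.1
  obtain ⟨t₁, ht₁⟩ := hne
  obtain ⟨y, hy, hty⟩ := hper.exists_mem_Ico hT t₁ t
  have : u y = 0 := hsub ⟨hy.1, hy.2.le⟩
  linarith

/-- The integral of `a` over the cell `[k h, (k + 1) h]`. -/
def cellWeight (a : ℝ → ℝ) (h : ℝ) (k : ℤ) : ℝ := ∫ s in (k * h)..((k + 1) * h), a s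

/-- A small negative perturbation of the density on the cells without positive weight. -/
def cellPert (a : ℝ → ℝ) (h : ℝ) (k : ℤ) : ℝ := if 0 < cellWeight a h k then 0 else -h

/-- The perturbed cell weights. -/
def gridWeight (a : ℝ → ℝ) (h : ℝ) (k : ℤ) : ℝ := cellWeight a h k + cellPert a h k * h

section

variable {a : ℝ → ℝ} {h : ℝ}

theorem abs_cellPert_le (hh : 0 < h) (k : ℤ) : |cellPert a h k| ≤ h := by
  unfold cellPert; split_ifs
  · simpa using hh.le
  · rw [abs_neg, abs_of_pos hh]

theorem gridWeight_of_pos {k : ℤ} (hk : 0 < cellWeight a h k) :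
    gridWeight a h k = cellWeight a h k := by
  simp [gridWeight, cellPert, hk]

theorem gridWeight_neg (hh : 0 < h) {k : ℤ} (hk : ¬ 0 < cellWeight a h k) :
    gridWeight a h k < 0 := by
  simp only [gridWeight, cellPert, if_neg hk]
  nlinarith

theorem gridWeight_ne_zero (hh : 0 < h) (k : ℤ) : gridWeight a h k ≠ 0 := by
  by_cases hk : 0 < cellWeight a h k
  · rw [gridWeight_of_pos hk]; exact hk.ne'
  · exact (gridWeight_neg hh hk).ne

theorem gridWeight_le (hh : 0 < h) (k : ℤ) : gridWeight a h k ≤ cellWeight a h k := by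
  by_cases hk : 0 < cellWeight a h k
  · rw [gridWeight_of_pos hk]
  · simp only [gridWeight, cellPert, if_neg hk]
    nlinarith

theorem abs_gridWeight_le (hh : 0 < h) (k : ℤ) :
    |gridWeight a h k| ≤ cellWeight (fun s => |a s|) h k + h * h := by
  have h1 : |cellWeight a h k| ≤ cellWeight (fun s => |a s|) h k :=
    intervalIntegral.abs_integral_le_integral_abs (by nlinarith)
  have h2 : |cellPert a h k * h| ≤ h * h := by
    rw [abs_mul, abs_of_pos hh]
    exact mul_le_mul_of_nonneg_right (abs_cellPert_le hh k) hh.le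
  exact (abs_add_le _ _).trans (add_le_add h1 h2)

theorem gridWeight_eq_intervalIntegral (hi : ∀ x y, IntervalIntegrable a volume x y) (k : ℤ) :
    gridWeight a h k = ∫ s in (k * h)..((k + 1) * h), (a s + cellPert a h k) := by
  rw [intervalIntegral.integral_add (hi _ _) intervalIntegrable_const,
    intervalIntegral.integral_const]
  simp only [gridWeight, cellWeight, smul_eq_mul]; ring

theorem sum_cellWeight (hi : ∀ x y, IntervalIntegrable a volume x y) (i : ℤ) (n : ℕ) :
    ∑ j ∈ Finset.range n, cellWeight a h (i + j) = ∫ s in (i * h)..((i + n) * h), a s := by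
  induction n with
  | zero => simp
  | succ n ih =>
    rw [Finset.sum_range_succ, ih, cellWeight]
    push_cast
    rw [intervalIntegral.integral_add_adjacent_intervals (hi _ _) (hi _ _), add_assoc]

theorem sum_cellWeight_left (hi : ∀ x y, IntervalIntegrable a volume x y) (i : ℤ) (n : ℕ) :
    ∑ j ∈ Finset.range n, cellWeight a h (i - 1 - j) = ∫ s in ((i - n) * h)..(i * h), a s := by
  induction n with
  | zero => simp
  | succ n ih =>
    rw [Finset.sum_range_succ, ih, cellWeight, add_comm]
    push_cast
    rw [show (i : ℝ) - 1 - n + 1 = i - n by ring, show (i : ℝ) - (n + 1) = i - 1 - n by ring,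
      intervalIntegral.integral_add_adjacent_intervals (hi _ _) (hi _ _)]

theorem periodic_gridWeight {T : ℝ} (hper : Function.Periodic a T) {m : ℕ} (hm : m * h = T) :
    Function.Periodic (gridWeight a h) (m : ℤ) := fun k => by
  have h1 : cellWeight a h (k + m) = cellWeight a h k := by
    have := intervalIntegral_sub_int_mul hper 1 (((k + m : ℤ) : ℝ) * h) (((k + m : ℤ) + 1 : ℝ) * h)
    rw [cellWeight, ← this, cellWeight, ← hm]
    push_cast
    congr 1 <;> ring
  simp only [gridWeight, cellPert, h1]

/-- The perturbed weights, indexed by the cyclic grid. -/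
def cyclicWeight (a : ℝ → ℝ) (h : ℝ) (m : ℕ) (i : ZMod m) : ℝ := gridWeight a h i.val

theorem cyclicWeight_intCast {T : ℝ} (hper : Function.Periodic a T) {m : ℕ} [NeZero m]
    (hm : m * h = T) (k : ℤ) : cyclicWeight a h m k = gridWeight a h k := by
  rw [cyclicWeight, ZMod.val_intCast]
  have h1 := (periodic_gridWeight hper hm).sub_zsmul_eq (x := k) (k / m)
  rwa [smul_eq_mul, mul_comm, ← Int.emod_def] at h1

theorem sum_zmod_val {m : ℕ} [NeZero m] (F : ℕ → ℝ) :
    ∑ i : ZMod m, F i.val = ∑ k ∈ Finset.range m, F k := by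
  cases m with
  | zero => exact absurd rfl (NeZero.ne 0)
  | succ n => exact Fin.sum_univ_eq_sum_range F (n + 1)

theorem sum_zmod_cellWeight (hi : ∀ x y, IntervalIntegrable a volume x y) {T : ℝ} {m : ℕ}
    [NeZero m] (hm : m * h = T) :
    ∑ i : ZMod m, cellWeight a h i.val = ∫ s in (0 : ℝ)..T, a s := by
  rw [sum_zmod_val fun k => cellWeight a h k]
  have := sum_cellWeight (h := h) hi 0 m
  simpa [hm] using this

theorem sum_cyclicWeight_le (hi : ∀ x y, IntervalIntegrable a volume x y) (hh : 0 < h) {T : ℝ}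
    {m : ℕ} [NeZero m] (hm : m * h = T) :
    ∑ i, cyclicWeight a h m i ≤ ∫ s in (0 : ℝ)..T, a s := by
  rw [← sum_zmod_cellWeight hi hm]
  exact Finset.sum_le_sum fun i _ => gridWeight_le hh _

theorem sum_abs_cyclicWeight_le (hi : ∀ x y, IntervalIntegrable a volume x y) (hh : 0 < h)
    (hh1 : h ≤ 1) {T : ℝ} {m : ℕ} [NeZero m] (hm : m * h = T) :
    ∑ i, |cyclicWeight a h m i| ≤ (∫ s in (0 : ℝ)..T, |a s|) + T := by
  rw [← sum_zmod_cellWeight (fun x y => (hi x y).abs) hm]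
  have h1 : (m : ℝ) * (h * h) ≤ T := by
    rw [← mul_assoc, hm, ← hm]
    exact mul_le_of_le_one_right (by positivity) hh1
  calc ∑ i, |cyclicWeight a h m i|
      ≤ ∑ i : ZMod m, (cellWeight (fun s => |a s|) h i.val + h * h) :=
        Finset.sum_le_sum fun i _ => abs_gridWeight_le hh _
    _ = ∑ i : ZMod m, cellWeight (fun s => |a s|) h i.val + m * (h * h) := by
        rw [Finset.sum_add_distrib]; simp [ZMod.card]
    _ ≤ _ := by linarith

end

section

variable {m : ℕ} {h G : ℝ} {φ f : ℝ → ℝ} {b u : ZMod m → ℝ}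

/-- The discrete slopes `φ((u (i + 1) - u i) / h)`. -/
def gridSlope (h : ℝ) (φ : ℝ → ℝ) (u : ZMod m → ℝ) (i : ZMod m) : ℝ := φ ((u (i + 1) - u i) / h)

theorem gridSlope_nonpos_of_max (hh : 0 < h) (hm : Monotone φ) (h0 : φ 0 = 0) {i : ZMod m}
    (hi : ∀ j, u j ≤ u i) : gridSlope h φ u i ≤ 0 :=
  h0 ▸ hm (div_nonpos_of_nonpos_of_nonneg (by linarith [hi (i + 1)]) hh.le)

theorem gridSlope_nonneg_of_max (hh : 0 < h) (hm : Monotone φ) (h0 : φ 0 = 0) {i : ZMod m}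
    (hi : ∀ j, u j ≤ u i) : 0 ≤ gridSlope h φ u (i - 1) := by
  have : 0 ≤ (u (i - 1 + 1) - u (i - 1)) / h :=
    div_nonneg (by rw [sub_add_cancel]; linarith [hi (i - 1)]) hh.le
  exact h0 ▸ hm this

theorem neg_potential_nodeForce_le {β s : ℝ} (hs0 : 0 ≤ s) (hs1 : s ≤ 1)
    (hG : ∀ x ∈ Icc (0 : ℝ) 1, |f x| ≤ G) : -potential (nodeForce β f) s ≤ |β| * G * s := by
  have h1 : ‖∫ x in (0 : ℝ)..s, nodeForce β f x‖ ≤ |β| * G * |s - 0| := by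
    refine intervalIntegral.norm_integral_le_of_norm_le_const fun x hx => ?_
    rw [uIoc_of_le hs0] at hx
    simp only [nodeForce, min_eq_right hx.1.le, sub_zero, norm_mul, Real.norm_eq_abs]
    exact mul_le_mul_of_nonneg_left (hG x ⟨hx.1.le, hx.2.trans hs1⟩) (abs_nonneg _)
  rw [sub_zero, abs_of_nonneg hs0] at h1
  exact (neg_le_abs _).trans h1

variable [NeZero m]

theorem abs_gridSlope_sub_le
    (heq : ∀ i, gridSlope h φ u i - gridSlope h φ u (i - 1) = -(b i * f (u i)))
    (i j : ZMod m) : |gridSlope h φ u j - gridSlope h φ u i| ≤ ∑ k, |b k * f (u k)| := by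
  have h1 : ∀ n : ℕ, gridSlope h φ u (i + n) - gridSlope h φ u i
      = ∑ l ∈ Finset.range n, -(b (i + 1 + l) * f (u (i + 1 + l))) := by
    intro n
    induction n with
    | zero => simp
    | succ n ih =>
      rw [Finset.sum_range_succ, ← ih, ← heq]
      have h2 : i + 1 + (n : ZMod m) = i + ((n + 1 : ℕ) : ZMod m) := by push_cast; ring
      rw [h2, show i + ((n + 1 : ℕ) : ZMod m) - 1 = i + n by push_cast; ring]
      ring
  have h2 := h1 (j - i).val
  rw [ZMod.natCast_zmod_val, add_sub_cancel] at h2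
  rw [h2]
  refine (Finset.abs_sum_le_sum_abs _ _).trans ?_
  simp only [abs_neg]
  exact sum_range_le_sum_zmod (F := fun k => |b k * f (u k)|) (fun _ => abs_nonneg _) (i + 1)
    (ZMod.val_lt (j - i)).le

theorem abs_gridSlope_le (hh : 0 < h) (hm : Monotone φ) (h0 : φ 0 = 0)
    (heq : ∀ i, gridSlope h φ u i - gridSlope h φ u (i - 1) = -(b i * f (u i)))
    (j : ZMod m) : |gridSlope h φ u j| ≤ ∑ k, |b k * f (u k)| := by
  obtain ⟨i, hi⟩ := exists_forall_le_node u
  have h1 := (abs_le.1 (abs_gridSlope_sub_le heq i j)).2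
  have h2 := (abs_le.1 (abs_gridSlope_sub_le heq (i - 1) j)).1
  have h3 := gridSlope_nonpos_of_max hh hm h0 hi
  have h4 := gridSlope_nonneg_of_max hh hm h0 hi
  exact abs_le.2 ⟨by linarith, by linarith⟩

/-- The energy of a discrete solution with values in `[0, M] ⊆ [0, 1]` is at most a constant
times `M`. -/
theorem energy_le_of_solution (hh : 0 < h) (hφ : Continuous φ) (hm : Monotone φ)
    (heq : ∀ i, gridSlope h φ u i - gridSlope h φ u (i - 1) = -(b i * f (u i)))
    (hG : ∀ x ∈ Icc (0 : ℝ) 1, |f x| ≤ G) {M : ℝ} (hM1 : M ≤ 1) (hu0 : ∀ i, 0 ≤ u i)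
    (huM : ∀ i, u i ≤ M) :
    energy h φ (fun i => nodeForce (b i) f) u ≤ 2 * ((∑ i, |b i|) * G * M) := by
  have hG0 : 0 ≤ G := (abs_nonneg _).trans (hG 0 ⟨le_rfl, zero_le_one⟩)
  have h1 : ∀ i, h * potential φ ((u (i + 1) - u i) / h)
      ≤ u (i + 1) * gridSlope h φ u i - u i * gridSlope h φ u i := fun i => by
    have h2 := mul_le_mul_of_nonneg_left (hm.potential_le_mul hφ ((u (i + 1) - u i) / h)) hh.le
    refine h2.trans (le_of_eq ?_)
    simp only [gridSlope]
    field_simp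
  have h2 : ∑ i, u (i + 1) * gridSlope h φ u i = ∑ i, u i * gridSlope h φ u (i - 1) := by
    rw [← Equiv.sum_comp (Equiv.addRight (1 : ZMod m)) fun i => u i * gridSlope h φ u (i - 1)]
    simp
  have h3 : ∀ i, u i * gridSlope h φ u (i - 1) - u i * gridSlope h φ u i ≤ |b i| * G * M :=
    fun i => by
    have h4 : u i * gridSlope h φ u (i - 1) - u i * gridSlope h φ u i = b i * f (u i) * u i := by
      rw [← mul_sub]
      have := heq i
      rw [show gridSlope h φ u (i - 1) - gridSlope h φ u i = b i * f (u i) by linarith]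
      ring
    rw [h4]
    refine (le_abs_self _).trans ?_
    rw [abs_mul, abs_mul, abs_of_nonneg (hu0 i)]
    exact mul_le_mul (mul_le_mul_of_nonneg_left (hG _ ⟨hu0 i, (huM i).trans hM1⟩) (abs_nonneg _))
      (huM i) (hu0 i) (by positivity)
  have h5 : ∀ i, -potential (nodeForce (b i) f) (u i) ≤ |b i| * G * M := fun i =>
    (neg_potential_nodeForce_le (hu0 i) ((huM i).trans hM1) hG).trans
      (mul_le_mul_of_nonneg_left (huM i) (by positivity))
  have h6 : ∑ i, |b i| * G * M = (∑ i, |b i|) * G * M := by rw [Finset.sum_mul, Finset.sum_mul]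
  have h7 := Finset.sum_le_sum fun i (_ : i ∈ Finset.univ) => h1 i
  have h8 := Finset.sum_le_sum fun i (_ : i ∈ Finset.univ) => h3 i
  have h9 := Finset.sum_le_sum fun i (_ : i ∈ Finset.univ) => h5 i
  simp only [Finset.sum_sub_distrib, Finset.sum_neg_distrib] at h7 h8 h9
  rw [h6] at h8 h9
  simp only [energy, Finset.sum_sub_distrib]
  linarith

end

/-- A priori bound: if the weights are large on the positivity stretches, discrete solutions stay
below one. -/
theorem lt_one_of_discrete_solution {m : ℕ} [NeZero m] {T h ℓ A c₀ : ℝ} {a φ f : ℝ → ℝ}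
    {u : ZMod m → ℝ} (hh : 0 < h) (hmh : m * h = T) (hhℓ : 3 * h ≤ 2 * ℓ) (hℓ : 0 < ℓ)
    (hm : StrictMono φ) (h0 : φ 0 = 0) (hi : ∀ x y, IntervalIntegrable a volume x y)
    (haper : Function.Periodic a T)
    (hwt : ∀ x y, x < y → 0 < (∫ t in x..y, a t) → ∃ t ∈ Icc x y, IsWeightPoint a ℓ A t)
    (hfnn : ∀ s, 0 ≤ f s) (hfpos : ∀ s, 0 < s → 0 < f s) (hc₀ : 0 < c₀)
    (hfc : ∀ s, 1 / 2 ≤ s → c₀ * spread φ (2 / ℓ * s) ≤ f s) (hA : 1 < A * c₀)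
    (hu0 : ∀ i, 0 ≤ u i)
    (heq : ∀ i, gridSlope h φ u i - gridSlope h φ u (i - 1) = -(cyclicWeight a h m i * f (u i)))
    (i : ZMod m) : u i < 1 := by
  obtain ⟨i₀, hi₀⟩ := exists_forall_le_node u
  refine (hi₀ i).trans_lt ?_
  by_contra! hM
  set M := u i₀ with hMdef
  set U : ℤ → ℝ := fun k => u k with hU
  set k₀ : ℤ := (i₀.val : ℤ) with hk₀
  have hUk₀ : U k₀ = M := by simp [hU, hk₀, hMdef]
  have hUM : ∀ k, U k ≤ M := fun k => hi₀ _
  have hU0 : ∀ k, 0 ≤ U k := fun k => hu0 _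
  have heqU : ∀ k : ℤ, φ ((U (k + 1) - U k) / h) - φ ((U k - U (k - 1)) / h)
      = -(gridWeight a h k * f (U k)) := fun k => by
    have h1 := heq k
    rw [cyclicWeight_intCast haper hmh] at h1
    simp only [gridSlope, sub_add_cancel] at h1
    simp only [hU]
    push_cast
    exact h1
  have hcell : 0 < cellWeight a h k₀ := by
    by_contra hneg
    have h1 := mul_neg_of_neg_of_pos (gridWeight_neg hh hneg) (hfpos M (by linarith))
    have h2 := heq i₀
    have h3 := gridSlope_nonpos_of_max hh hm.monotone h0 hi₀
    have h4 := gridSlope_nonneg_of_max hh hm.monotone h0 hi₀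
    simp only [cyclicWeight] at h2
    linarith
  have hΓ : ∀ s, M / 2 ≤ s → s ≤ M → c₀ * spread φ (M / ℓ) ≤ f s := fun s hs _ => by
    refine le_trans (mul_le_mul_of_nonneg_left ((strictMono_spread hm).monotone ?_) hc₀.le)
      (hfc s (by linarith))
    calc M / ℓ = 2 / ℓ * (M / 2) := by field_simp
      _ ≤ 2 / ℓ * s := mul_le_mul_of_nonneg_left hs (by positivity)
  have hMℓ : 0 < M / ℓ := by positivity
  have hsp := spread_pos hm hMℓ
  have hcontra : ¬ A * (c₀ * spread φ (M / ℓ)) ≤ spread φ (M / ℓ) := by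
    rw [← mul_assoc, not_le]
    nlinarith
  set n := ⌈ℓ / h⌉₊ with hn
  have hn1 : ℓ ≤ n * h := by
    rw [← div_le_iff₀ hh]; exact Nat.le_ceil _
  have hn2 : n * h < ℓ + h := by
    have := Nat.ceil_lt_add_one (div_nonneg hℓ.le hh.le)
    rw [← lt_div_iff₀ hh, add_div, div_self hh.ne']
    exact this
  obtain ⟨t, ht, hR | hL⟩ := hwt (k₀ * h) ((k₀ + 1) * h) (by nlinarith) hcell
  · have hpos : ∀ j : ℕ, j < 2 * n → 0 < cellWeight a h (k₀ + (j + 1 : ℕ)) := fun j hj => by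
      have hj' : (j : ℝ) + 1 ≤ 2 * n := by exact_mod_cast hj
      have hj0 : (0 : ℝ) ≤ j := Nat.cast_nonneg j
      refine (hR _ _ ?_ ?_ ?_).1
      · push_cast; nlinarith [ht.2]
      · nlinarith
      · push_cast; nlinarith [ht.1]
    refine hcontra ((discrete_weight_le (U := fun j => U (k₀ + j))
      (β := fun j => gridWeight a h (k₀ + j)) hh hℓ hm h0 hn1 (by simpa using hUk₀)
      (fun j => hUM _) (fun j => hU0 _) (fun j _ => ?_)
      (fun j hj => ?_) hfnn hΓ ?_ (mul_nonneg hc₀.le hsp.le)).trans ?_)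
    · have h1 := heqU (k₀ + (j + 1 : ℕ))
      rw [show k₀ + ((j + 1 : ℕ) : ℤ) + 1 = k₀ + ((j + 2 : ℕ) : ℤ) by push_cast; ring,
        show k₀ + ((j + 1 : ℕ) : ℤ) - 1 = k₀ + (j : ℤ) by push_cast; ring] at h1
      exact h1
    · rw [gridWeight_of_pos (hpos j hj)]; exact (hpos j hj).le
    · have h1 : ∑ j ∈ Finset.range n, gridWeight a h (k₀ + (j + 1 : ℕ))
          = ∑ j ∈ Finset.range n, cellWeight a h (k₀ + 1 + j) :=
        Finset.sum_congr rfl fun j hj => by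
          rw [gridWeight_of_pos (hpos j (by have := Finset.mem_range.1 hj; omega))]
          congr 1; push_cast; ring
      rw [h1, sum_cellWeight hi]
      refine (hR _ _ ?_ ?_ ?_).2 ?_
      · push_cast; exact ht.2
      · push_cast; nlinarith
      · push_cast; nlinarith [ht.1]
      · push_cast; nlinarith
    · have := hm hMℓ
      simp only [spread]; linarith
  · have hpos : ∀ j : ℕ, j < 2 * n → 0 < cellWeight a h (k₀ - (j + 1 : ℕ)) := fun j hj => by
      have hj' : (j : ℝ) + 1 ≤ 2 * n := by exact_mod_cast hj
      have hj0 : (0 : ℝ) ≤ j := Nat.cast_nonneg j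
      refine (hL _ _ ?_ ?_ ?_).1
      · push_cast; nlinarith [ht.2]
      · nlinarith
      · push_cast; nlinarith [ht.1]
    have hmneg : StrictMono fun x => -φ (-x) := fun x y hxy => neg_lt_neg (hm (neg_lt_neg hxy))
    refine hcontra ((discrete_weight_le (φ := fun x => -φ (-x)) (U := fun j => U (k₀ - j))
      (β := fun j => gridWeight a h (k₀ - j)) hh hℓ hmneg (by simp [h0]) hn1 (by simpa using hUk₀)
      (fun j => hUM _) (fun j => hU0 _) (fun j _ => ?_)
      (fun j hj => ?_) hfnn hΓ ?_ (mul_nonneg hc₀.le hsp.le)).trans ?_)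
    · have h1 := heqU (k₀ - (j + 1 : ℕ))
      rw [show k₀ - ((j + 1 : ℕ) : ℤ) + 1 = k₀ - (j : ℤ) by push_cast; ring,
        show k₀ - ((j + 1 : ℕ) : ℤ) - 1 = k₀ - ((j + 2 : ℕ) : ℤ) by push_cast; ring] at h1
      simp only [← neg_div, neg_sub]
      linarith
    · rw [gridWeight_of_pos (hpos j hj)]; exact (hpos j hj).le
    · have h1 : ∑ j ∈ Finset.range n, gridWeight a h (k₀ - (j + 1 : ℕ))
          = ∑ j ∈ Finset.range n, cellWeight a h (k₀ - 1 - j) :=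
        Finset.sum_congr rfl fun j hj => by
          rw [gridWeight_of_pos (hpos j (by have := Finset.mem_range.1 hj; omega))]
          congr 1; push_cast; ring
      rw [h1, sum_cellWeight_left hi]
      refine (hL _ _ ?_ ?_ ?_).2 ?_
      · nlinarith [ht.2]
      · nlinarith
      · exact ht.1
      · nlinarith
    · have := hm (neg_lt_zero.2 hMℓ)
      simp only [spread, neg_neg]; linarith

theorem IsWeightPoint.exists_cellWeight_pos {a : ℝ → ℝ} {ℓ A t h : ℝ} (ht : IsWeightPoint a ℓ A t)
    (hh : 0 < h) (hhℓ : 3 * h ≤ 2 * ℓ) : ∃ k : ℤ, 0 < cellWeight a h k := by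
  have key : ∀ x : ℝ, x ≤ ⌈x / h⌉ * h ∧ ⌈x / h⌉ * h < x + h := fun x => by
    refine ⟨(div_le_iff₀ hh).1 (Int.le_ceil _), ?_⟩
    rw [← lt_div_iff₀ hh, add_div, div_self hh.ne']
    exact Int.ceil_lt_add_one _
  obtain hR | hL := ht
  · obtain ⟨h1, h2⟩ := key t
    exact ⟨⌈t / h⌉, (hR _ _ h1 (by nlinarith) (by nlinarith)).1⟩
  · obtain ⟨h1, h2⟩ := key (t - 4 * ℓ)
    exact ⟨⌈(t - 4 * ℓ) / h⌉, (hL _ _ h1 (by nlinarith) (by nlinarith)).1⟩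

theorem IsWeightPoint.const_mul {a : ℝ → ℝ} {ℓ A t c : ℝ} (ht : IsWeightPoint a ℓ A t)
    (hc : 0 < c) : IsWeightPoint (fun s => c * a s) ℓ (c * A) t := by
  simp only [IsWeightPoint, intervalIntegral.integral_const_mul]
  refine ht.imp (fun h x y h1 h2 h3 => ?_) (fun h x y h1 h2 h3 => ?_) <;>
  exact ⟨mul_pos hc (h x y h1 h2 h3).1,
    fun h4 => mul_le_mul_of_nonneg_left ((h x y h1 h2 h3).2 h4) hc.le⟩

/-- An energy barrier at level `c` produces a solution of the discrete problem with values in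
`[0, 1]` whose maximum is bounded below independently of the mesh. -/
theorem GridSolution.nonempty_of_barrier {m : ℕ} [NeZero m] {T h ℓ A c₀ r c B G : ℝ}
    {a φ f ψ : ℝ → ℝ} (hm2 : 2 ≤ m) (hh : 0 < h) (hh1 : h ≤ 1) (hmh : m * h = T)
    (hhℓ : 3 * h ≤ 2 * ℓ) (hℓ : 0 < ℓ) (hφ : Continuous φ) (hm : StrictMono φ) (h0 : φ 0 = 0)
    (hψφ : ∀ y, ψ (φ y) = y) (hi : ∀ x y, IntervalIntegrable a volume x y)
    (haper : Function.Periodic a T)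
    (hwt : ∀ x y, x < y → 0 < (∫ t in x..y, a t) → ∃ t ∈ Icc x y, IsWeightPoint a ℓ A t)
    (hex : ∃ t, IsWeightPoint a ℓ A t) (hf : Continuous f) (hf0 : ∀ s ≤ 0, f s = 0)
    (hfpos : ∀ s, 0 < s → 0 < f s) (hc₀ : 0 < c₀)
    (hfc : ∀ s, 1 / 2 ≤ s → c₀ * spread φ (2 / ℓ * s) ≤ f s) (hA : 1 < A * c₀)
    (hgrow : ∀ ε > 0, ∀ K : ℝ, ∀ᶠ s in atTop, 1 + φ (K * s) - φ (-(K * s)) < ε * f s)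
    (hr : 0 < r) (hc : 0 < c)
    (hbar : ∀ u : ZMod m → ℝ, (∀ i, u i ≤ r) → (∃ i, u i = r) →
      c ≤ energy h φ (fun i => nodeForce (cyclicWeight a h m i) f) u)
    (hG : ∀ x ∈ Icc (0 : ℝ) 1, |f x| ≤ G) (hB : (∫ t in (0 : ℝ)..T, |a t|) + T ≤ B) :
    Nonempty (GridSolution T 1 (B * G) (c / (2 * (B * G) + 1)) a f ψ h) := by
  have hfnn : ∀ s, 0 ≤ f s := fun s =>
    (le_or_gt s 0).elim (fun hs => (hf0 s hs).ge) fun hs => (hfpos s hs).le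
  obtain ⟨k₁, hk₁⟩ := hex.choose_spec.exists_cellWeight_pos hh hhℓ
  have hbpos : ∃ i : ZMod m, 0 < cyclicWeight a h m i :=
    ⟨k₁, by rw [cyclicWeight_intCast haper hmh, gridWeight_of_pos hk₁]; exact hk₁⟩
  obtain ⟨u, hu0, heq', hcu⟩ := exists_discrete_solution hm2 hh hφ hm.monotone hf hfnn hf0
    (fun i => gridWeight_ne_zero hh _) hbpos hgrow hr hc hbar
  have heq : ∀ i, gridSlope h φ u i - gridSlope h φ u (i - 1)
      = -(cyclicWeight a h m i * f (u i)) := fun i => by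
    simp only [gridSlope, sub_add_cancel]; exact heq' i
  have hu1 : ∀ i, u i ≤ 1 := fun i => (lt_one_of_discrete_solution hh hmh hhℓ hℓ hm h0 hi haper hwt
    hfnn hfpos hc₀ hfc hA hu0 heq i).le
  have hG0 : 0 ≤ G := (abs_nonneg _).trans (hG 0 ⟨le_rfl, zero_le_one⟩)
  have hsum : ∑ i, |cyclicWeight a h m i| ≤ B := (sum_abs_cyclicWeight_le hi hh hh1 hmh).trans hB
  have hB0 : 0 ≤ B := (Finset.sum_nonneg fun i _ => abs_nonneg _).trans hsum
  obtain ⟨i₀, hi₀⟩ := exists_forall_le_node u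
  have hstep : ∀ k : ℤ, gridSlope h φ u (k - 1 : ℤ) = gridSlope h φ u ((k : ZMod m) - 1) :=
    fun k => by push_cast; rfl
  refine ⟨⟨fun k => u k, fun k => gridSlope h φ u k, cellPert a h, fun k => ⟨hu0 _, hu1 _⟩,
    fun k => ?_, fun k => ?_, fun k => ?_, fun k => ?_, ⟨i₀.val, ?_, ?_, ?_⟩, m, ?_, fun k => ?_⟩⟩
  · refine (abs_gridSlope_le hh hm.monotone h0 heq _).trans ?_
    refine le_trans ?_ (mul_le_mul_of_nonneg_right hsum hG0)
    rw [Finset.sum_mul]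
    refine Finset.sum_le_sum fun i _ => ?_
    rw [abs_mul]
    exact mul_le_mul_of_nonneg_left (hG _ ⟨hu0 i, hu1 i⟩) (abs_nonneg _)
  · rw [one_mul]; exact abs_cellPert_le hh k
  · simp only [gridSlope, hψφ]
    push_cast
    field_simp
  · rw [← gridWeight_eq_intervalIntegral hi, ← cyclicWeight_intCast haper hmh, hstep]
    exact heq k
  · positivity
  · rw [← hmh]
    have : (i₀.val : ℝ) ≤ m := by exact_mod_cast (ZMod.val_lt i₀).le
    push_cast
    exact mul_le_mul_of_nonneg_right this hh.le
  · have h1 := hcu.trans (energy_le_of_solution hh hφ hm.monotone heq hG (hu1 i₀) hu0 hi₀)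
    have h2 : (∑ i, |cyclicWeight a h m i|) * G * u i₀ ≤ B * G * u i₀ :=
      mul_le_mul_of_nonneg_right (mul_le_mul_of_nonneg_right hsum hG0) (hu0 i₀)
    have h3 : u ((i₀.val : ℤ) : ZMod m) = u i₀ := by simp
    rw [h3, div_le_iff₀ (by positivity)]
    nlinarith [hu0 i₀]
  · exact_mod_cast hmh
  · simp

open Topology in
/-- Existence of a nontrivial periodic solution of the integral equations for a weight of negative
mean that is large on its positivity stretches. -/
theorem exists_periodic_solution {T ℓ A c₀ : ℝ} {a φ f ψ : ℝ → ℝ} (hT : 0 < T) (hℓ : 0 < ℓ)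
    (hφ : Continuous φ) (hm : StrictMono φ) (h0 : φ 0 = 0) (hψ : Continuous ψ)
    (hψφ : ∀ y, ψ (φ y) = y) (hi : ∀ x y, IntervalIntegrable a volume x y)
    (haper : Function.Periodic a T) (haneg : (∫ t in (0 : ℝ)..T, a t) < 0)
    (hwt : ∀ x y, x < y → 0 < (∫ t in x..y, a t) → ∃ t ∈ Icc x y, IsWeightPoint a ℓ A t)
    (hex : ∃ t, IsWeightPoint a ℓ A t) (hf : Continuous f) (hf0 : ∀ s ≤ 0, f s = 0)
    (hfpos : ∀ s, 0 < s → 0 < f s)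
    (hσ : ∀ K : ℝ, 1 < K → ∃ C, ∀ᶠ s in 𝓝[>] (0 : ℝ), φ (K * s) ≤ C * φ s)
    (hosc : ∃ η₀ : ℝ, 0 < η₀ ∧ η₀ < 1 ∧ ∀ᶠ s in 𝓝[>] (0 : ℝ),
      ∀ ω ∈ Icc (1 - η₀) 1, f s / 2 ≤ f (ω * s) ∧ f (ω * s) ≤ 2 * f s)
    (hsmall : ∀ ε > 0, ∀ᶠ s in 𝓝[>] (0 : ℝ), f s ≤ ε * φ s) (hc₀ : 0 < c₀)
    (hfc : ∀ s, 1 / 2 ≤ s → c₀ * spread φ (2 / ℓ * s) ≤ f s) (hA : 1 < A * c₀)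
    (hgrow : ∀ ε > 0, ∀ K : ℝ, ∀ᶠ s in atTop, 1 + φ (K * s) - φ (-(K * s)) < ε * f s) :
    ∃ u p : ℝ → ℝ, Continuous p ∧ Function.Periodic u T ∧ (∀ t, u t ∈ Icc (0 : ℝ) 1) ∧
      (∃ t, 0 < u t) ∧ (∀ t, HasDerivAt u (ψ (p t)) t) ∧
      ∀ t, p t = p 0 - ∫ s in (0 : ℝ)..t, a s * f (u s) := by
  set B := (∫ t in (0 : ℝ)..T, |a t|) + T with hB
  have hB0 : 0 ≤ B :=
    add_nonneg (intervalIntegral.integral_nonneg hT.le fun t _ => abs_nonneg _) hT.le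
  obtain ⟨r, c, hr, hc, hbar⟩ :=
    exists_energy_barrier hT hB0 (neg_pos.2 haneg) hφ hm h0 hf hf0 hfpos hσ hosc hsmall
  obtain ⟨G, hG⟩ := isCompact_Icc.exists_bound_of_continuousOn (s := Icc (0 : ℝ) 1) hf.continuousOn
  have hG0 : 0 ≤ G := (norm_nonneg _).trans (hG 0 ⟨le_rfl, zero_le_one⟩)
  have hlim : Tendsto (fun n : ℕ => T / n) atTop (𝓝 0) := tendsto_const_div_atTop_nhds_zero_nat T
  obtain ⟨n₀, hn₀⟩ := eventually_atTop.1
    ((hlim.eventually_le_const (lt_min one_pos (half_pos hℓ))).and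
      (eventually_ge_atTop 2))
  have hh : ∀ n : ℕ, 0 < T / ((n + n₀ : ℕ) : ℝ) := fun n => by
    have := (hn₀ (n + n₀) (Nat.le_add_left _ _)).2
    have : (0 : ℝ) < (n + n₀ : ℕ) := by exact_mod_cast (by omega : 0 < n + n₀)
    positivity
  have hS : ∀ n : ℕ, Nonempty
      (GridSolution T 1 (B * G) (c / (2 * (B * G) + 1)) a f ψ (T / ((n + n₀ : ℕ) : ℝ))) :=
    fun n => by
    obtain ⟨h1, h2⟩ := hn₀ (n + n₀) (Nat.le_add_left _ _)
    have hne : NeZero (n + n₀) := ⟨by omega⟩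
    have h3 : T / ((n + n₀ : ℕ) : ℝ) ≤ 1 := h1.trans (min_le_left _ _)
    have h4 : T / ((n + n₀ : ℕ) : ℝ) ≤ ℓ / 2 := h1.trans (min_le_right _ _)
    have hmT : ((n + n₀ : ℕ) : ℝ) * (T / ((n + n₀ : ℕ) : ℝ)) = T :=
      mul_div_cancel₀ _ (Nat.cast_ne_zero.2 hne.out)
    refine GridSolution.nonempty_of_barrier h2 (hh n) h3 hmT (by linarith) hℓ hφ hm h0 hψφ hi haper
      hwt hex hf hf0 hfpos hc₀ hfc hA hgrow hr hc ?_ hG le_rfl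
    exact hbar (n + n₀) _ _ hmT (sum_abs_cyclicWeight_le hi (hh n) h3 hmT)
      (by rw [neg_neg]; exact sum_cyclicWeight_le hi (hh n) hmT)
  obtain ⟨u, p, hp, hper, hu, ⟨t, ht⟩, hdu, hpe⟩ := GridSolution.exists_solution hi hf hψ hh
    (fun n => (hn₀ (n + n₀) (Nat.le_add_left _ _)).1.trans (min_le_left _ _))
    (hlim.comp (tendsto_add_atTop_nat n₀)) zero_le_one fun n => (hS n).some
  exact ⟨u, p, hp, hper, hu, ⟨t, lt_of_lt_of_le (by positivity) ht⟩, hdu, hpe⟩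

theorem statement14
    (T : ℝ) (hT : 0 < T)
    (φ : ℝ → ℝ) (hφc : Continuous φ) (hφm : StrictMono φ)
    (hφs : Function.Surjective φ) (hφ0 : φ 0 = 0)
    -- upper σ-condition at zero: `limsup_{s→0⁺} |φ(σ s)|/φ(s) < +∞` for `|σ| > 1`
    (hφσ : ∀ c : ℝ, 1 < |c| → ∃ C : ℝ,
      ∀ᶠ s in nhdsWithin 0 (Set.Ioi (0:ℝ)), |φ (c * s)| / φ s ≤ C)
    (a : ℝ → ℝ) (haloc : LocallyIntegrable a volume)
    (haper : Function.Periodic a T)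
    (haneg : (∫ t in (0:ℝ)..T, a t) < 0)
    (N : ℕ) (σ τ : Fin (N + 1) → ℝ) (hstar : SignChanging T a N σ τ)
    (g : ℝ → ℝ) (hgc : ContinuousOn g (Set.Ici 0))
    (hg0 : g 0 = 0) (hgpos : ∀ s : ℝ, 0 < s → 0 < g s)
    (hreg : RegOscZero g)
    (hgφ : Tendsto (fun s => g s / φ s) (nhdsWithin 0 (Set.Ioi 0)) (nhds 0)) :
    ∃ lam0 : ℝ, 0 < lam0 ∧ ∀ lam : ℝ, lam0 < lam →
      ∃ u : ℝ → ℝ,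
        IsPhiLapSol T φ (fun t x => -(lam * a t * g x)) u ∧ ∀ t, 0 < u t := by
  have hi : ∀ x y, IntervalIntegrable a volume x y := fun x y =>
    (haloc.integrableOn_isCompact isCompact_uIcc).intervalIntegrable
  have hφpos : ∀ s, 0 < s → 0 < φ s := fun s hs => hφ0 ▸ hφm hs
  set e := hφm.orderIsoOfSurjective φ hφs
  have hφe : ∀ y, φ (e.symm y) = y := e.apply_symm_apply
  have heφ : ∀ y, e.symm (φ y) = y := e.symm_apply_apply
  have hec : Continuous e.symm := e.symm.continuous
  have hfg : ∀ s ∈ Icc (0 : ℝ) 1, truncForce φ g s = g s := fun s hs => truncForce_eq hs.1 hs.2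
  have hpos1 : ∀ᶠ s in nhdsWithin 0 (Ioi (0 : ℝ)), s ∈ Ioc (0 : ℝ) 1 :=
    Ioc_mem_nhdsGT one_pos
  have hσ : ∀ K : ℝ, 1 < K → ∃ C, ∀ᶠ s in nhdsWithin 0 (Ioi (0 : ℝ)), φ (K * s) ≤ C * φ s :=
    fun K hK => by
      obtain ⟨C, hC⟩ := hφσ K (hK.trans_le (le_abs_self K))
      refine ⟨C, ?_⟩
      filter_upwards [hC, hpos1] with s hs hs1
      exact (le_abs_self _).trans ((div_le_iff₀ (hφpos s hs1.1)).1 hs)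
  have hosc : ∃ η₀ : ℝ, 0 < η₀ ∧ η₀ < 1 ∧ ∀ᶠ s in nhdsWithin 0 (Ioi (0 : ℝ)),
      ∀ ω ∈ Icc (1 - η₀) 1, truncForce φ g s / 2 ≤ truncForce φ g (ω * s) ∧
        truncForce φ g (ω * s) ≤ 2 * truncForce φ g s := by
    obtain ⟨η₀, h1, h2, h3⟩ := hreg.eventually_comparable hgpos
    refine ⟨η₀, h1, h2, ?_⟩
    filter_upwards [h3, hpos1] with s hs hs1 ω hω
    rw [hfg s ⟨hs1.1.le, hs1.2⟩, hfg (ω * s) ⟨mul_nonneg (by linarith [hω.1]) hs1.1.le,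
      (mul_le_of_le_one_left hs1.1.le hω.2).trans hs1.2⟩]
    exact hs ω hω
  have hsmall : ∀ ε > 0, ∀ᶠ s in nhdsWithin 0 (Ioi (0 : ℝ)), truncForce φ g s ≤ ε * φ s :=
    fun ε hε => by
      filter_upwards [hgφ.eventually_le_const hε, hpos1] with s hs hs1
      rw [hfg s ⟨hs1.1.le, hs1.2⟩]
      exact (div_le_iff₀ (hφpos s hs1.1)).1 hs
  obtain ⟨ℓ, A, hℓ, hA, hwt⟩ := hstar.exists_weightPoint hT hi haper
  obtain ⟨t₀, -, ht₀⟩ := hwt (σ 0) (τ 0) (hstar.1 0)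
    (intervalIntegral_pos_of_ae_pos (hi _ _) (hstar.1 0) (hstar.2.2.2.1 0))
  obtain ⟨c₀, hc₀, hfc⟩ := exists_mul_spread_le_truncForce hφc hφm hgc hgpos (2 / ℓ) (by positivity)
  refine ⟨1 / (A * c₀), by positivity, fun lam hlam => ?_⟩
  have hlam0 : 0 < lam := lt_trans (by positivity) hlam
  rw [div_lt_iff₀ (by positivity)] at hlam
  have hfc' := continuous_truncForce hφc hgc
  have hi' : ∀ x y, IntervalIntegrable (fun s => lam * a s) volume x y := fun x y =>
    (hi x y).const_mul lam
  obtain ⟨u, p, hp, hper, hu, hne, hdu, hpe⟩ := exists_periodic_solution (A := lam * A) hT hℓ hφc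
    hφm hφ0 hec heφ hi' (fun t => by simp only [haper t])
    (by rw [intervalIntegral.integral_const_mul]; exact mul_neg_of_pos_of_neg hlam0 haneg)
    (fun x y hxy hxyp => by
      rw [intervalIntegral.integral_const_mul] at hxyp
      obtain ⟨t, ht, hw⟩ := hwt x y hxy (pos_of_mul_pos_right hxyp hlam0.le)
      exact ⟨t, ht, hw.const_mul hlam0⟩)
    ⟨t₀, ht₀.const_mul hlam0⟩ hfc' (fun s hs => truncForce_of_nonpos hg0 hs)
    (fun s hs => truncForce_pos hφm hgpos hs) hσ hosc hsmall hc₀ hfc (by linarith)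
    (fun ε hε K => eventually_spread_lt_truncForce hφm hgpos hε K)
  have huc : Continuous u := continuous_iff_continuousAt.2 fun t => (hdu t).continuousAt
  obtain ⟨δ₀, hδ₀, hδ⟩ := (mem_nhdsGT_iff_exists_Ioo_subset (a := (0 : ℝ))).1 (hsmall 1 one_pos)
  have hfφ : ∀ s, 0 ≤ s → s < δ₀ → truncForce φ g s ≤ φ s := fun s hs hsδ => by
    rcases hs.eq_or_lt with rfl | hs
    · rw [truncForce_of_nonpos hg0 le_rfl, hφ0]
    · have h1 : truncForce φ g s ≤ 1 * φ s := hδ ⟨hs, hsδ⟩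
      rwa [one_mul] at h1
  refine ⟨u, ⟨hper, fun t => e.symm (p t), hec.comp hp, hdu, fun t₁ t₂ => ?_, fun t => ?_⟩,
    pos_of_periodic_solution hT hφm hφ0 hφe hi' hfc' (truncForce_nonneg hφm hg0 hgpos) hδ₀ hfφ hper
      (fun t => (hu t).1) hne hdu hpe⟩
  · have h1 := ((hi' t₁ t₂).mul_continuousOn (hfc'.comp huc).continuousOn).neg
    refine h1.congr fun s _ => ?_
    simp [hfg _ (hu s)]
  · simp only [hφe, intervalIntegral.integral_neg]
    rw [hpe t, sub_eq_add_neg]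
    simp only [hfg _ (hu _)]
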